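/- arXiv:2208.09726 — 2 statements merged into one kernel-verified Lean document; each statement's English description precedes it below -/
import Mathlib

section
/- Let (Ω, Σ, μ) be a probability space and let (f_n)_{n≥1} be any sequence of non-negative real-valued random variables on Ω. Then there exist a measurable function f : Ω → [0, +∞] and a strictly increasing map φ : ℕ → ℕ such that, setting g_n = f_{φ(n)}, for every strictly increasing map ψ : ℕ → ℕ the Cesàro means (1/n) ∑_{k=1}^n g_{ψ(k)}(ω) converge to f(ω) in [0, +∞] for μ-almost every ω ∈ Ω. -/
open MeasureTheory Filter Topology

/-- A bounded sequence in a Hilbert space whose inner products with each of its own terms converge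
is weakly convergent. -/
theorem exists_weak_limit_of_cauchySeq_inner {H : Type*} [NormedAddCommGroup H]
    [InnerProductSpace ℝ H] [CompleteSpace H] {u : ℕ → H} {C : ℝ} (hC : ∀ n, ‖u n‖ ≤ C)
    (hu : ∀ m, CauchySeq fun n => inner ℝ (u n) (u m)) :
    ∃ h : H, ∀ v, Tendsto (fun n => inner ℝ (u n) v) atTop (𝓝 (inner ℝ h v)) := by
  let M : Submodule ℝ H :=
    { carrier := {v | CauchySeq fun n => inner ℝ (u n) v}
      add_mem' := fun {a b} ha hb => by
        have ha' : CauchySeq fun n => inner ℝ (u n) a := ha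
        have hb' : CauchySeq fun n => inner ℝ (u n) b := hb
        change CauchySeq fun n => inner ℝ (u n) (a + b)
        simp only [inner_add_right]
        exact ha'.add hb'
      zero_mem' := by simpa using cauchySeq_const (0 : ℝ)
      smul_mem' := fun c a ha => by
        obtain ⟨l, hl⟩ := cauchySeq_tendsto_of_complete ha
        change CauchySeq fun n => inner ℝ (u n) (c • a)
        simpa only [inner_smul_right] using (hl.const_mul c).cauchySeq }
  have hC0 : 0 ≤ C := (norm_nonneg _).trans (hC 0)
  have hclosed : IsClosed (M : Set H) := by
    refine isClosed_of_closure_subset fun v hv => ?_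
    refine Metric.cauchySeq_iff'.2 fun ε hε => ?_
    obtain ⟨w, hwM, hw⟩ := Metric.mem_closure_iff.1 hv (ε / (3 * (C + 1))) (by positivity)
    have hwM' : CauchySeq fun n => inner ℝ (u n) w := hwM
    obtain ⟨N, hN⟩ := Metric.cauchySeq_iff'.1 hwM' (ε / 3) (by positivity)
    have key : ∀ n, |inner ℝ (u n) (v - w)| < ε / 3 := fun n => by
      rw [dist_eq_norm] at hw
      calc |inner ℝ (u n) (v - w)| ≤ ‖u n‖ * ‖v - w‖ := abs_real_inner_le_norm _ _
        _ ≤ (C + 1) * ‖v - w‖ := by gcongr; linarith [hC n]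
        _ < (C + 1) * (ε / (3 * (C + 1))) := by gcongr
        _ = ε / 3 := by field_simp
    refine ⟨N, fun n hn => ?_⟩
    have h1 := hN n hn
    have h2 := key n
    have h3 := key N
    rw [Real.dist_eq] at h1 ⊢
    rw [inner_sub_right] at h2 h3
    rw [abs_lt] at *
    constructor <;> linarith
  have hperp : Mᗮ = ⊥ := by
    refine (Submodule.eq_bot_iff _).2 fun x hx => ?_
    have h0 : ∀ n, inner ℝ (u n) x = 0 := fun n => (Submodule.mem_orthogonal M x).1 hx _ (hu n)
    have hxM : x ∈ M := by
      change CauchySeq fun n => inner ℝ (u n) x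
      simpa only [h0] using cauchySeq_const (0 : ℝ)
    exact inner_self_eq_zero.1 ((Submodule.mem_orthogonal M x).1 hx x hxM)
  have htop : ∀ v, CauchySeq fun n => inner ℝ (u n) v := fun v => by
    have h : v ∈ M.topologicalClosure := by
      rw [Submodule.topologicalClosure_eq_top_iff.2 hperp]; trivial
    rwa [hclosed.submodule_topologicalClosure_eq] at h
  choose l hl using fun v => cauchySeq_tendsto_of_complete (htop v)
  let T : H →L[ℝ] ℝ := continuousLinearMapOfTendsto (fun n => innerSL ℝ (u n))
    (tendsto_pi_nhds.2 hl)
  refine ⟨(InnerProductSpace.toDual ℝ H).symm T, fun v => ?_⟩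
  rw [InnerProductSpace.toDual_symm_apply]
  exact hl v

theorem integrable_of_measurable_of_abs_le {Ω : Type*} [MeasurableSpace Ω] {μ : Measure Ω}
    [IsFiniteMeasure μ] {v : Ω → ℝ} (hv : Measurable v) {C : ℝ} (hC : ∀ ω, |v ω| ≤ C) :
    Integrable v μ :=
  Integrable.of_bound hv.aestronglyMeasurable C (ae_of_all _ hC)

/-- Simultaneous weak sequential compactness of countably many sequences of `[0, 1]`-valued
functions, tested against bounded measurable functions. -/
theorem exists_subseq_tendsto_integral_mul {Ω : Type*} [MeasurableSpace Ω] (μ : Measure Ω)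
    [IsProbabilityMeasure μ] (u : ℕ → ℕ → Ω → ℝ) (hu : ∀ n k, Measurable (u n k))
    (h0 : ∀ n k ω, 0 ≤ u n k ω) (h1 : ∀ n k ω, u n k ω ≤ 1) :
    ∃ φ : ℕ → ℕ, StrictMono φ ∧ ∃ d : ℕ → Ω → ℝ, (∀ k, Measurable (d k)) ∧
      (∀ k ω, 0 ≤ d k ω) ∧ (∀ k ω, d k ω ≤ 1) ∧
      ∀ k (v : Ω → ℝ), Measurable v → ∀ C, (∀ ω, |v ω| ≤ C) →
        Tendsto (fun n => ∫ ω, u (φ n) k ω * v ω ∂μ) atTop (𝓝 (∫ ω, d k ω * v ω ∂μ)) := by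
  have habs : ∀ n k ω, |u n k ω| ≤ 1 := fun n k ω =>
    abs_le.2 ⟨by linarith [h0 n k ω], h1 n k ω⟩
  have hmem : ∀ {v : Ω → ℝ}, Measurable v → ∀ C, (∀ ω, |v ω| ≤ C) → MemLp v 2 μ :=
    fun hv C hC => MemLp.of_bound hv.aestronglyMeasurable C (ae_of_all _ hC)
  have hU : ∀ n k, MemLp (u n k) 2 μ := fun n k => hmem (hu n k) 1 (habs n k)
  let U : ℕ → ℕ → Lp ℝ 2 μ := fun n k => (hU n k).toLp
  have hUnorm : ∀ n k, ‖U n k‖ ≤ 1 := fun n k => by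
    have h := eLpNorm_le_of_ae_bound (p := 2) (μ := μ) (f := u n k) (ae_of_all _ (habs n k))
    rw [Lp.norm_toLp]
    refine ENNReal.toReal_le_of_le_ofReal zero_le_one ?_
    simpa using h
  have hinner : ∀ {v w : Ω → ℝ} (hv : MemLp v 2 μ) (hw : MemLp w 2 μ),
      inner ℝ hv.toLp hw.toLp = ∫ ω, v ω * w ω ∂μ := fun hv hw => by
    rw [L2.inner_def]
    refine integral_congr_ae ?_
    filter_upwards [hv.coeFn_toLp, hw.coeFn_toLp] with ω h1 h2
    rw [h1, h2]
    simp [mul_comm]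
  let x : ℕ → (ℕ × ℕ × ℕ → ℝ) := fun n p => inner ℝ (U n p.1) (U p.2.1 p.2.2)
  have hcomp : IsCompact (Set.pi Set.univ fun _ : ℕ × ℕ × ℕ => Set.Icc (-1 : ℝ) 1) :=
    isCompact_univ_pi fun _ => isCompact_Icc
  obtain ⟨a, -, φ, hφ, hlim⟩ := hcomp.isSeqCompact (x := x) fun n p _ => by
    refine abs_le.1 ?_
    calc |x n p| ≤ ‖U n p.1‖ * ‖U p.2.1 p.2.2‖ := abs_real_inner_le_norm _ _
      _ ≤ 1 * 1 := by gcongr <;> apply hUnorm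
      _ = 1 := one_mul 1
  have hlim' := tendsto_pi_nhds.1 hlim
  have hex : ∀ k, ∃ h : Lp ℝ 2 μ, ∀ v,
      Tendsto (fun n => inner ℝ (U (φ n) k) v) atTop (𝓝 (inner ℝ h v)) := fun k =>
    exists_weak_limit_of_cauchySeq_inner (fun n => hUnorm (φ n) k)
      fun m => (hlim' (k, φ m, k)).cauchySeq
  choose h hh using hex
  have hweak : ∀ k {v : Ω → ℝ}, Measurable v → ∀ C, (∀ ω, |v ω| ≤ C) →
      Tendsto (fun n => ∫ ω, u (φ n) k ω * v ω ∂μ) atTop (𝓝 (∫ ω, h k ω * v ω ∂μ)) := by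
    intro k v hv C hC
    have := hh k (hmem hv C hC).toLp
    simp only [U, hinner] at this
    convert this using 2
    conv_rhs => rw [← Lp.toLp_coeFn (h k) (Lp.memLp (h k))]
    rw [hinner]
  have hint : ∀ k, Integrable (h k) μ := fun k => (Lp.memLp (h k)).integrable (by norm_num)
  have hset : ∀ k (s : Set Ω), MeasurableSet s →
      Tendsto (fun n => ∫ ω in s, u (φ n) k ω ∂μ) atTop (𝓝 (∫ ω in s, h k ω ∂μ)) := by
    intro k s hs
    have := hweak k (v := s.indicator fun _ => 1) (measurable_const.indicator hs) 1 fun ω => by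
      by_cases hω : ω ∈ s <;> simp [hω]
    have e : ∀ g : Ω → ℝ, ∫ ω, g ω * s.indicator (fun _ => 1) ω ∂μ = ∫ ω in s, g ω ∂μ :=
      fun g => by
        rw [← integral_indicator hs]
        congr 1 with ω
        by_cases hω : ω ∈ s <;> simp [hω]
    simpa only [e] using this
  have huint : ∀ n k, Integrable (u n k) μ := fun n k =>
    integrable_of_measurable_of_abs_le (hu n k) (habs n k)
  have hnonneg : ∀ k, ∀ᵐ ω ∂μ, 0 ≤ h k ω := fun k =>
    ae_le_of_forall_setIntegral_le (f := fun _ => (0 : ℝ)) (integrable_const _) (hint k)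
      fun s hs _ => by
        rw [integral_zero]
        exact ge_of_tendsto' (hset k s hs) fun n => integral_nonneg fun ω => h0 _ _ _
  have hle : ∀ k, ∀ᵐ ω ∂μ, h k ω ≤ 1 := fun k =>
    ae_le_of_forall_setIntegral_le (g := fun _ => (1 : ℝ)) (hint k) (integrable_const _)
      fun s hs _ => le_of_tendsto' (hset k s hs) fun n =>
        integral_mono (huint _ _).integrableOn (integrable_const _) fun ω => h1 _ _ _
  refine ⟨φ, hφ, fun k ω => max 0 (min 1 (h k ω)), fun k => ?_, fun k ω => le_max_left _ _,
    fun k ω => max_le zero_le_one (min_le_left _ _), fun k v hv C hC => ?_⟩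
  · exact measurable_const.max (measurable_const.min (Lp.stronglyMeasurable (h k)).measurable)
  · convert hweak k hv C hC using 2
    refine integral_congr_ae ?_
    filter_upwards [hnonneg k, hle k] with ω h2 h3
    rw [min_eq_right h3, max_eq_right h2]

theorem exists_strictMono_forall_subseq {R : ℕ → ℕ → Prop} (hR : ∀ N, ∀ᶠ n in atTop, R N n) :
    ∃ φ : ℕ → ℕ, StrictMono φ ∧ ∀ ψ : ℕ → ℕ, StrictMono ψ → ∀ j,
      ∃ N, j ≤ N ∧ (∀ i ≤ j, φ (ψ i) ≤ N) ∧ R N (φ (ψ (j + 1))) := by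
  choose t ht using fun N => eventually_atTop.1 (hR N)
  let s : ℕ → ℕ := fun N => max (N + 1) (t N)
  let φ : ℕ → ℕ := fun m => s^[m] 0
  have hsucc : ∀ m, φ (m + 1) = s (φ m) := fun m => Function.iterate_succ_apply' s m 0
  have hφ : StrictMono φ := strictMono_nat_of_lt_succ fun m => by
    rw [hsucc]
    exact lt_of_lt_of_le (Nat.lt_succ_self _) (le_max_left _ _)
  refine ⟨φ, hφ, fun ψ hψ j => ⟨φ (ψ (j + 1) - 1), ?_, fun i hi => ?_, ?_⟩⟩
  · have h1 := hψ.le_apply (x := j + 1)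
    have h2 := hφ.le_apply (x := ψ (j + 1) - 1)
    omega
  · refine hφ.monotone ?_
    have := hψ (Nat.lt_succ_of_le hi)
    simp only [Nat.succ_eq_add_one] at this
    omega
  · have h1 := hψ.le_apply (x := j + 1)
    obtain ⟨m, hm⟩ : ∃ m, ψ (j + 1) = m + 1 := ⟨ψ (j + 1) - 1, by omega⟩
    rw [hm, Nat.add_sub_cancel, hsucc]
    exact ht _ _ (le_max_right _ _)

/-- Countably many uniformly bounded sequences converging weakly to zero have a common subsequence which,
together with all its own subsequences, is almost orthogonal with respect to finitely many weights. -/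
theorem exists_subseq_almost_orthogonal {Ω ι : Type*} [Finite ι] [MeasurableSpace Ω]
    (μ : Measure Ω) (Z : ℕ → ℕ → Ω → ℝ) (hZ : ∀ n k, Measurable (Z n k))
    (hZ1 : ∀ n k ω, |Z n k ω| ≤ 1) (W : ι → Ω → ℝ) (hW : ∀ b, Measurable (W b))
    (hW1 : ∀ b ω, |W b ω| ≤ 1)
    (hlim : ∀ k (v : Ω → ℝ), Measurable v → (∀ ω, |v ω| ≤ 1) →
      Tendsto (fun n => ∫ ω, Z n k ω * v ω ∂μ) atTop (𝓝 0)) :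
    ∃ φ : ℕ → ℕ, StrictMono φ ∧ ∀ ψ : ℕ → ℕ, StrictMono ψ → ∀ j b, ∀ k ≤ j,
      |∫ ω, Z (φ (ψ (j + 1))) k ω * W b ω ∂μ| ≤ (1 / 2) ^ j ∧
      ∀ i ≤ j, ∀ l ≤ j,
        |∫ ω, Z (φ (ψ (j + 1))) k ω * (Z (φ (ψ i)) l ω * W b ω) ∂μ| ≤ (1 / 2) ^ j := by
  have hev : ∀ N k (v : Ω → ℝ), Measurable v → (∀ ω, |v ω| ≤ 1) →
      ∀ᶠ n in atTop, |∫ ω, Z n k ω * v ω ∂μ| ≤ (1 / 2) ^ N := fun N k v hv hv1 => by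
    have h := (hlim k v hv hv1).abs
    rw [abs_zero] at h
    exact h.eventually_le_const (by positivity)
  obtain ⟨φ, hφ, h⟩ := exists_strictMono_forall_subseq
    (R := fun N n => ∀ b, ∀ k ∈ Set.Iic N, |∫ ω, Z n k ω * W b ω ∂μ| ≤ (1 / 2) ^ N ∧
      ∀ i ∈ Set.Iic N, ∀ l ∈ Set.Iic N,
        |∫ ω, Z n k ω * (Z i l ω * W b ω) ∂μ| ≤ (1 / 2) ^ N) fun N => by
    refine eventually_all.2 fun b => (eventually_all_finite (Set.finite_Iic N)).2 fun k _ =>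
      (hev N k _ (hW b) (hW1 b)).and <| (eventually_all_finite (Set.finite_Iic N)).2 fun i _ =>
      (eventually_all_finite (Set.finite_Iic N)).2 fun l _ => hev N k _ ((hZ i l).mul (hW b)) ?_
    intro ω
    rw [abs_mul]
    exact mul_le_one₀ (hZ1 i l ω) (abs_nonneg _) (hW1 b ω)
  refine ⟨φ, hφ, fun ψ hψ j b k hk => ?_⟩
  obtain ⟨N, hjN, hN, hR⟩ := h ψ hψ j
  have hpow : ((1 : ℝ) / 2) ^ N ≤ (1 / 2) ^ j :=
    pow_le_pow_of_le_one (by norm_num) (by norm_num) hjN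
  exact ⟨(hR b k (hk.trans hjN)).1.trans hpow, fun i hi l hl =>
    ((hR b k (hk.trans hjN)).2 _ (hN i hi) l (hl.trans hjN)).trans hpow⟩

theorem summable_sum_range_floor_pow_div_sq {V : ℕ → ℝ} (hV : ∀ j, 0 ≤ V j) (hV0 : V 0 = 0)
    (hs : Summable fun j : ℕ => V j / (j : ℝ) ^ 2) {c : ℝ} (hc : 1 < c) :
    Summable fun i : ℕ => (∑ j ∈ Finset.range ⌊c ^ i⌋₊, V j) / (⌊c ^ i⌋₊ : ℝ) ^ 2 := by
  have hK : 0 ≤ c ^ 5 * (c - 1)⁻¹ ^ 3 := by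
    have : 0 < c - 1 := by linarith
    positivity
  refine summable_of_sum_range_le (c := c ^ 5 * (c - 1)⁻¹ ^ 3 * ∑' j : ℕ, V j / (j : ℝ) ^ 2)
    (fun i => div_nonneg (Finset.sum_nonneg fun j _ => hV j) (by positivity)) fun M => ?_
  have hfloor : ∀ i ∈ Finset.range M, ⌊c ^ i⌋₊ ≤ ⌊c ^ M⌋₊ := fun i hi =>
    Nat.floor_mono (pow_le_pow_right₀ hc.le (Finset.mem_range.1 hi).le)
  calc ∑ i ∈ Finset.range M, (∑ j ∈ Finset.range ⌊c ^ i⌋₊, V j) / (⌊c ^ i⌋₊ : ℝ) ^ 2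
      = ∑ i ∈ Finset.range M, ∑ j ∈ Finset.range ⌊c ^ M⌋₊,
          if j < ⌊c ^ i⌋₊ then V j * (1 / (⌊c ^ i⌋₊ : ℝ) ^ 2) else 0 := by
        refine Finset.sum_congr rfl fun i hi => ?_
        rw [← Finset.sum_filter, Finset.sum_div]
        refine Finset.sum_congr ?_ fun j _ => by ring
        ext j
        have := hfloor i hi
        simp only [Finset.mem_range, Finset.mem_filter]
        omega
    _ = ∑ j ∈ Finset.range ⌊c ^ M⌋₊,
          V j * ∑ i ∈ Finset.range M with (j : ℝ) < ⌊c ^ i⌋₊, 1 / (⌊c ^ i⌋₊ : ℝ) ^ 2 := by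
        rw [Finset.sum_comm]
        refine Finset.sum_congr rfl fun j _ => ?_
        rw [Finset.sum_filter, Finset.mul_sum]
        simp only [Nat.cast_lt, mul_ite, mul_zero]
    _ ≤ ∑ j ∈ Finset.range ⌊c ^ M⌋₊, c ^ 5 * (c - 1)⁻¹ ^ 3 * (V j / (j : ℝ) ^ 2) := by
        refine Finset.sum_le_sum fun j _ => ?_
        rcases Nat.eq_zero_or_pos j with rfl | hj
        · simp [hV0]
        · calc _ ≤ V j * (c ^ 5 * (c - 1)⁻¹ ^ 3 / (j : ℝ) ^ 2) :=
                mul_le_mul_of_nonneg_left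
                  (sum_div_nat_floor_pow_sq_le_div_sq M (by exact_mod_cast hj) hc) (hV j)
            _ = _ := by ring
    _ ≤ _ := by
        rw [← Finset.mul_sum]
        exact mul_le_mul_of_nonneg_left
          (hs.sum_le_tsum _ fun j _ => div_nonneg (hV j) (by positivity)) hK

theorem ae_tendsto_zero_of_summable_integral {Ω : Type*} [MeasurableSpace Ω] {μ : Measure Ω}
    {u : ℕ → Ω → ℝ} (hu : ∀ j, Integrable (u j) μ) (h0 : ∀ j ω, 0 ≤ u j ω)
    (hs : Summable fun j => ∫ ω, u j ω ∂μ) :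
    ∀ᵐ ω ∂μ, Tendsto (fun j => u j ω) atTop (𝓝 0) := by
  have hm : ∀ j, AEMeasurable (fun ω => ENNReal.ofReal (u j ω)) μ := fun j =>
    (hu j).aemeasurable.ennreal_ofReal
  have hfin : ∫⁻ ω, ∑' j, ENNReal.ofReal (u j ω) ∂μ ≠ ⊤ := by
    rw [lintegral_tsum hm]
    simp only [← ofReal_integral_eq_lintegral_ofReal (hu _) (ae_of_all _ (h0 _))]
    exact hs.tsum_ofReal_ne_top
  filter_upwards [ae_lt_top' (AEMeasurable.tsum hm) hfin] with ω hω
  have h := ENNReal.tendsto_atTop_zero_of_tsum_ne_top hω.ne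
  have h' := (ENNReal.tendsto_toReal ENNReal.zero_ne_top).comp h
  simpa only [Function.comp_def, ENNReal.toReal_ofReal (h0 _ _), ENNReal.toReal_zero] using h'

/-- Almost orthogonal functions obey the law of large numbers along geometric sequences. -/
theorem ae_tendsto_sum_range_floor_pow_div {Ω : Type*} [MeasurableSpace Ω] (μ : Measure Ω)
    [IsFiniteMeasure μ] {X : ℕ → Ω → ℝ} (hX : ∀ j, Measurable (X j))
    (hXj : ∀ (j : ℕ) ω, |X j ω| ≤ j) {W : Ω → ℝ} (hW : Measurable W) (hW0 : ∀ ω, 0 ≤ W ω)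
    (hW1 : ∀ ω, W ω ≤ 1)
    (hV : Summable fun j : ℕ => (∫ ω, X j ω ^ 2 * W ω ∂μ) / (j : ℝ) ^ 2) {B : ℕ → ℝ}
    (hB : Summable fun j : ℕ => ((j : ℝ) + 1) * B j)
    (hcross : ∀ j, ∀ i ≤ j, |∫ ω, X (j + 1) ω * (X i ω * W ω) ∂μ| ≤ B j)
    {c : ℝ} (hc : 1 < c) :
    ∀ᵐ ω ∂μ, 0 < W ω →
      Tendsto (fun i : ℕ => (∑ j ∈ Finset.range ⌊c ^ i⌋₊, X j ω) / (⌊c ^ i⌋₊ : ℝ))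
        atTop (𝓝 0) := by
  have hWabs : ∀ ω, |W ω| ≤ 1 := fun ω => abs_le.2 ⟨by linarith [hW0 ω], hW1 ω⟩
  have hX0 : ∀ ω, X 0 ω = 0 := fun ω => by simpa using hXj 0 ω
  have hprod : ∀ {f g : Ω → ℝ} {C D : ℝ}, Measurable f → Measurable g → (∀ ω, |f ω| ≤ C) →
      (∀ ω, |g ω| ≤ D) → Integrable (fun ω => f ω * (g ω * W ω)) μ := by
    intro f g C D hf hg hC hD
    refine integrable_of_measurable_of_abs_le (hf.mul (hg.mul hW)) (C := C * (D * 1)) fun ω => ?_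
    have hC0 := (abs_nonneg _).trans (hC ω)
    have hD0 := (abs_nonneg _).trans (hD ω)
    simp only [abs_mul]
    gcongr
    exacts [hC ω, hD ω, hWabs ω]
  have hB0 : ∀ j, 0 ≤ B j := fun j => (abs_nonneg _).trans (hcross j 0 (Nat.zero_le j))
  let V : ℕ → ℝ := fun j => ∫ ω, X j ω ^ 2 * W ω ∂μ
  let C : ℕ → ℝ := fun j => (j : ℝ) * B (j - 1)
  have hV0 : ∀ j, 0 ≤ V j := fun j => integral_nonneg fun ω => mul_nonneg (sq_nonneg _) (hW0 ω)
  have hC0 : ∀ j, 0 ≤ C j := fun j => mul_nonneg (Nat.cast_nonneg _) (hB0 _)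
  have hCs : Summable C := (summable_nat_add_iff 1).1 (by simpa [C] using hB)
  have hs : Summable fun j : ℕ => (V j + 2 * C j) / (j : ℝ) ^ 2 := by
    have h2 : Summable fun j : ℕ => 2 * C j / (j : ℝ) ^ 2 := by
      refine Summable.of_nonneg_of_le (fun j => ?_) (fun j => ?_) (hCs.mul_left 2)
      · have := hC0 j
        positivity
      · rcases Nat.eq_zero_or_pos j with rfl | hj
        · simp [C]
        · refine div_le_self (mul_nonneg zero_le_two (hC0 j)) ?_
          exact one_le_pow₀ (by exact_mod_cast hj)
    simpa only [add_div] using hV.add h2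
  let S : ℕ → Ω → ℝ := fun N ω => ∑ j ∈ Finset.range N, X j ω
  have hS : ∀ N, Measurable (S N) := fun N => Finset.measurable_fun_sum _ fun j _ => hX j
  have hSb : ∀ N ω, |S N ω| ≤ ∑ j ∈ Finset.range N, (j : ℝ) := fun N ω =>
    (Finset.abs_sum_le_sum_abs _ _).trans (Finset.sum_le_sum fun j _ => hXj j ω)
  have hSint : ∀ N, Integrable (fun ω => S N ω ^ 2 * W ω) μ := fun N => by
    simpa only [sq, mul_assoc] using hprod (hS N) (hS N) (hSb N) (hSb N)
  have hbound : ∀ N, ∫ ω, S N ω ^ 2 * W ω ∂μ ≤ ∑ j ∈ Finset.range N, (V j + 2 * C j) := by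
    intro N
    induction N with
    | zero => simp [S]
    | succ N ih =>
      have hcrossN : ∫ ω, X N ω * (S N ω * W ω) ∂μ ≤ C N := by
        rcases N with _ | N
        · simp [S, C]
        · have e : ∀ ω, X (N + 1) ω * (S (N + 1) ω * W ω) =
              ∑ i ∈ Finset.range (N + 1), X (N + 1) ω * (X i ω * W ω) := fun ω => by
            simp only [S, Finset.sum_mul, Finset.mul_sum]
          simp only [e]
          rw [integral_finsetSum _ fun i _ => hprod (hX _) (hX i) (hXj _) (hXj i)]
          calc _ ≤ ∑ i ∈ Finset.range (N + 1), B N := Finset.sum_le_sum fun i hi =>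
                (le_abs_self _).trans (hcross N i (Nat.lt_succ_iff.1 (Finset.mem_range.1 hi)))
            _ = C (N + 1) := by simp [C]
      have e : ∀ ω, S (N + 1) ω ^ 2 * W ω =
          S N ω ^ 2 * W ω + (X N ω ^ 2 * W ω + 2 * (X N ω * (S N ω * W ω))) := fun ω => by
        simp only [S, Finset.sum_range_succ]
        ring
      have i1 : Integrable (fun ω => X N ω ^ 2 * W ω) μ := by
        simpa only [sq, mul_assoc] using hprod (hX N) (hX N) (hXj N) (hXj N)
      have i2 := (hprod (hX N) (hS N) (hXj N) (hSb N)).const_mul 2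
      have i3 : Integrable (fun ω => X N ω ^ 2 * W ω + 2 * (X N ω * (S N ω * W ω))) μ := i1.add i2
      rw [Finset.sum_range_succ, integral_congr_ae (ae_of_all _ e),
        integral_add (hSint N) i3, integral_add i1 i2, integral_const_mul]
      exact add_le_add ih (by simp only [V]; linarith)
  have hsum := summable_sum_range_floor_pow_div_sq
    (fun j => add_nonneg (hV0 j) (mul_nonneg zero_le_two (hC0 j))) (by simp [V, C, hX0]) hs hc
  have hae := ae_tendsto_zero_of_summable_integral (μ := μ)
    (u := fun i ω => S ⌊c ^ i⌋₊ ω ^ 2 * W ω / (⌊c ^ i⌋₊ : ℝ) ^ 2)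
    (fun i => (hSint _).div_const _)
    (fun i ω => div_nonneg (mul_nonneg (sq_nonneg _) (hW0 ω)) (sq_nonneg _))
    (Summable.of_nonneg_of_le (fun i => integral_nonneg fun ω =>
      div_nonneg (mul_nonneg (sq_nonneg _) (hW0 ω)) (sq_nonneg _)) (fun i => by
        rw [integral_div]
        exact div_le_div_of_nonneg_right (hbound _) (sq_nonneg _)) hsum)
  filter_upwards [hae] with ω hω hpos
  have h1 := (hω.div_const (W ω)).sqrt
  rw [zero_div, Real.sqrt_zero] at h1
  refine (tendsto_zero_iff_abs_tendsto_zero _).2 (h1.congr fun i => ?_)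
  rw [Function.comp_apply, ← Real.sqrt_sq_eq_abs, div_pow]
  congr 1
  field_simp
  rfl

theorem summable_sum_range_mul_div_sq {a : ℕ → ℝ} (ha : ∀ k, 0 ≤ a k) (hs : Summable a) :
    Summable fun j : ℕ => (∑ k ∈ Finset.range j, ((k : ℝ) + 1) * a k) / (j : ℝ) ^ 2 := by
  refine summable_of_sum_range_le (c := 2 * ∑' k, a k) (fun j => div_nonneg
    (Finset.sum_nonneg fun k _ => mul_nonneg (by positivity) (ha k)) (by positivity)) fun M => ?_
  calc ∑ j ∈ Finset.range M, (∑ k ∈ Finset.range j, ((k : ℝ) + 1) * a k) / (j : ℝ) ^ 2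
      = ∑ j ∈ Finset.range M, ∑ k ∈ Finset.range j, ((k : ℝ) + 1) * a k * ((j : ℝ) ^ 2)⁻¹ := by
        simp only [div_eq_mul_inv, Finset.sum_mul]
    _ = ∑ k ∈ Finset.range M, ∑ j ∈ Finset.Ioo k M,
          ((k : ℝ) + 1) * a k * ((j : ℝ) ^ 2)⁻¹ := by
        refine Finset.sum_comm' fun j k => ?_
        simp only [Finset.mem_range, Finset.mem_Ioo]
        omega
    _ ≤ ∑ k ∈ Finset.range M, 2 * a k := by
        refine Finset.sum_le_sum fun k _ => ?_
        rw [← Finset.mul_sum]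
        calc _ ≤ ((k : ℝ) + 1) * a k * (2 / ((k : ℝ) + 1)) :=
              mul_le_mul_of_nonneg_left (sum_Ioo_inv_sq_le k M) (mul_nonneg (by positivity) (ha k))
          _ = 2 * a k := by field_simp
    _ ≤ 2 * ∑' k, a k := by
        rw [← Finset.mul_sum]
        exact mul_le_mul_of_nonneg_left (hs.sum_le_tsum _ fun k _ => ha k) zero_le_two

theorem sq_sum_range_le {x : ℕ → ℝ} (h0 : ∀ k, 0 ≤ x k) (h1 : ∀ k, x k ≤ 1) (n : ℕ) :
    (∑ k ∈ Finset.range n, x k) ^ 2 ≤ ∑ k ∈ Finset.range n, 2 * ((k : ℝ) + 1) * x k := by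
  induction n with
  | zero => simp
  | succ n ih =>
    have hs : ∑ k ∈ Finset.range n, x k ≤ n := by
      simpa using Finset.sum_le_sum fun k (_ : k ∈ Finset.range n) => h1 k
    rw [Finset.sum_range_succ, Finset.sum_range_succ]
    nlinarith [mul_le_mul_of_nonneg_right hs (h0 n), mul_le_mul_of_nonneg_right (h1 n) (h0 n), h0 n]

theorem abs_sub_le_one {x y : ℝ} (hx0 : 0 ≤ x) (hx1 : x ≤ 1) (hy0 : 0 ≤ y) (hy1 : y ≤ 1) :
    |x - y| ≤ 1 :=
  abs_le.2 ⟨by linarith, by linarith⟩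

theorem summable_add_one_pow_mul_half_pow (r : ℕ) :
    Summable fun j : ℕ => ((j : ℝ) + 1) ^ r * (1 / 2) ^ j := by
  have h := (summable_nat_add_iff 1).2
    (summable_pow_mul_geometric_of_norm_lt_one r (r := (1 / 2 : ℝ)) (by norm_num))
  refine (h.mul_left 2).congr fun j => ?_
  push_cast
  ring

theorem integrable_mul_of_mem_unitInterval {Ω : Type*} [MeasurableSpace Ω] {μ : Measure Ω}
    [IsFiniteMeasure μ] {x W : Ω → ℝ} (hx : Measurable x) (hx0 : ∀ ω, 0 ≤ x ω)
    (hx1 : ∀ ω, x ω ≤ 1) (hW : Measurable W) (hW0 : ∀ ω, 0 ≤ W ω) (hW1 : ∀ ω, W ω ≤ 1) :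
    Integrable (fun ω => x ω * W ω) μ :=
  integrable_of_measurable_of_abs_le (hx.mul hW) (C := 1) fun ω => by
    rw [abs_of_nonneg (mul_nonneg (hx0 ω) (hW0 ω))]
    exact mul_le_one₀ (hx1 ω) (hW0 ω) (hW1 ω)

theorem integral_mul_le_add_of_abs_integral_sub_mul_le {Ω : Type*} [MeasurableSpace Ω]
    {μ : Measure Ω} {x y W : Ω → ℝ} (hx : Integrable (fun ω => x ω * W ω) μ)
    (hy : Integrable (fun ω => y ω * W ω) μ) {ε : ℝ}
    (h : |∫ ω, (x ω - y ω) * W ω ∂μ| ≤ ε) :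
    ∫ ω, x ω * W ω ∂μ ≤ ∫ ω, y ω * W ω ∂μ + ε := by
  have h' := (le_abs_self _).trans h
  simp only [sub_mul] at h'
  rw [integral_sub hx hy] at h'
  linarith

/-- If the centred layers `D j k - d k` are almost orthogonal, then the Cesàro means of the
truncations `∑ k < L j, D j k` converge to the limit of `∑ k < L j, d k`. -/
theorem ae_tendsto_cesaro_layers
    {Ω : Type*} [MeasurableSpace Ω] (μ : Measure Ω) [IsFiniteMeasure μ]
    {D : ℕ → ℕ → Ω → ℝ} (hD : ∀ j k, Measurable (D j k)) (hD0 : ∀ j k ω, 0 ≤ D j k ω)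
    (hD1 : ∀ j k ω, D j k ω ≤ 1) {d : ℕ → Ω → ℝ} (hd : ∀ k, Measurable (d k))
    (hd0 : ∀ k ω, 0 ≤ d k ω) (hd1 : ∀ k ω, d k ω ≤ 1) {W : Ω → ℝ} (hW : Measurable W)
    (hW0 : ∀ ω, 0 ≤ W ω) (hW1 : ∀ ω, W ω ≤ 1)
    (hcross : ∀ j, ∀ k ≤ j, ∀ i ≤ j, ∀ l ≤ j,
      |∫ ω, (D (j + 1) k ω - d k ω) * ((D i l ω - d l ω) * W ω) ∂μ| ≤ (1 / 2) ^ j)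
    {L : ℕ → ℕ} (hL : ∀ j, L j ≤ j)
    (hV : Summable fun j : ℕ =>
      (∫ ω, (∑ k ∈ Finset.range (L j), (D j k ω - d k ω)) ^ 2 * W ω ∂μ) / (j : ℝ) ^ 2) :
    ∀ᵐ ω ∂μ, 0 < W ω → ∀ l : ℝ,
      Tendsto (fun j => ∑ k ∈ Finset.range (L j), d k ω) atTop (𝓝 l) →
      Tendsto (fun n : ℕ => (∑ j ∈ Finset.range n, ∑ k ∈ Finset.range (L j), D j k ω) / (n : ℝ))
        atTop (𝓝 l) := by
  let X : ℕ → Ω → ℝ := fun j ω => ∑ k ∈ Finset.range (L j), (D j k ω - d k ω)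
  have hZ : ∀ j k ω, |D j k ω - d k ω| ≤ 1 := fun j k ω =>
    abs_sub_le_one (hD0 j k ω) (hD1 j k ω) (hd0 k ω) (hd1 k ω)
  have hX : ∀ j, Measurable (X j) := fun j =>
    Finset.measurable_fun_sum _ fun k _ => (hD j k).sub (hd k)
  have hXj : ∀ (j : ℕ) ω, |X j ω| ≤ j := fun j ω =>
    calc |X j ω| ≤ ∑ k ∈ Finset.range (L j), |D j k ω - d k ω| := Finset.abs_sum_le_sum_abs _ _
      _ ≤ ∑ k ∈ Finset.range (L j), 1 := Finset.sum_le_sum fun k _ => hZ j k ω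
      _ = (L j : ℝ) := by simp
      _ ≤ j := by exact_mod_cast hL j
  have hcrossX : ∀ j, ∀ i ≤ j,
      |∫ ω, X (j + 1) ω * (X i ω * W ω) ∂μ| ≤ ((j : ℝ) + 1) ^ 2 * (1 / 2) ^ j := by
    intro j i hi
    have e : ∀ ω, X (j + 1) ω * (X i ω * W ω) =
        ∑ k ∈ Finset.range (L (j + 1)), ∑ l ∈ Finset.range (L i),
          (D (j + 1) k ω - d k ω) * ((D i l ω - d l ω) * W ω) := fun ω => by
      simp only [X, Finset.sum_mul, Finset.mul_sum]
      rw [Finset.sum_comm]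
    have hint : ∀ k l, Integrable
        (fun ω => (D (j + 1) k ω - d k ω) * ((D i l ω - d l ω) * W ω)) μ := fun k l => by
      refine integrable_of_measurable_of_abs_le
        (((hD _ k).sub (hd k)).mul (((hD i l).sub (hd l)).mul hW)) (C := 1 * (1 * 1)) fun ω => ?_
      simp only [abs_mul]
      gcongr
      exacts [hZ _ _ _, hZ _ _ _, abs_le.2 ⟨by linarith [hW0 ω], hW1 ω⟩]
    simp only [e]
    rw [integral_finsetSum _ fun k _ => integrable_finsetSum _ fun l _ => hint k l]
    have hLj := hL (j + 1)
    have hLi := hL i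
    calc _ ≤ ∑ k ∈ Finset.range (L (j + 1)), |∫ ω, ∑ l ∈ Finset.range (L i),
          (D (j + 1) k ω - d k ω) * ((D i l ω - d l ω) * W ω) ∂μ| :=
          Finset.abs_sum_le_sum_abs _ _
      _ ≤ ∑ k ∈ Finset.range (L (j + 1)), ∑ l ∈ Finset.range (L i), ((1 : ℝ) / 2) ^ j := by
          refine Finset.sum_le_sum fun k hk => ?_
          rw [integral_finsetSum _ fun l _ => hint k l]
          refine (Finset.abs_sum_le_sum_abs _ _).trans (Finset.sum_le_sum fun l hl => ?_)
          rw [Finset.mem_range] at hk hl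
          exact hcross j k (by omega) i hi l (by omega)
      _ = ((L (j + 1) : ℝ) * (L i : ℝ)) * (1 / 2) ^ j := by simp [mul_assoc]
      _ ≤ (((j : ℝ) + 1) * ((j : ℝ) + 1)) * (1 / 2) ^ j := by
          gcongr
          · exact_mod_cast hLj
          · exact_mod_cast (by omega : L i ≤ j + 1)
      _ = _ := by ring
  have hB : Summable fun j : ℕ => ((j : ℝ) + 1) * (((j : ℝ) + 1) ^ 2 * (1 / 2) ^ j) :=
    (summable_add_one_pow_mul_half_pow 3).congr fun j => by ring
  have hc1 : ∀ m : ℕ, (1 : ℝ) < 1 + 1 / ((m : ℝ) + 1) := fun m => by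
    have : (0 : ℝ) < 1 / ((m : ℝ) + 1) := by positivity
    linarith
  have hclim : Tendsto (fun m : ℕ => 1 + 1 / ((m : ℝ) + 1)) atTop (𝓝 1) := by
    simpa using tendsto_one_div_add_atTop_nhds_zero_nat.const_add (1 : ℝ)
  have hae := ae_all_iff.2 fun m : ℕ =>
    ae_tendsto_sum_range_floor_pow_div μ hX hXj hW hW0 hW1 hV hB hcrossX (hc1 m)
  filter_upwards [hae] with ω hω hpos l hl
  refine tendsto_div_of_monotone_of_tendsto_div_floor_pow
    (fun n => ∑ j ∈ Finset.range n, ∑ k ∈ Finset.range (L j), D j k ω) l ?_ _ hc1 hclim fun m => ?_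
  · exact monotone_nat_of_le_succ fun n => by
      rw [Finset.sum_range_succ]
      exact le_add_of_nonneg_right (Finset.sum_nonneg fun k _ => hD0 n k ω)
  · have hfl : Tendsto (fun i : ℕ => ⌊(1 + 1 / ((m : ℝ) + 1)) ^ i⌋₊) atTop atTop :=
      tendsto_nat_floor_atTop.comp (tendsto_pow_atTop_atTop_of_one_lt (hc1 m))
    have h := (hω m hpos).add (hl.cesaro.comp hfl)
    rw [zero_add] at h
    refine h.congr fun i => ?_
    simp only [X, Function.comp_apply, Finset.sum_sub_distrib]
    ring

/-- If the layers have nearly summable weighted integrals, the variances of the truncations satisfy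
Kolmogorov's summability condition. -/
theorem summable_integral_sq_layers_div_sq
    {Ω : Type*} [MeasurableSpace Ω] (μ : Measure Ω) [IsFiniteMeasure μ]
    {D : ℕ → ℕ → Ω → ℝ} (hD : ∀ j k, Measurable (D j k)) (hD0 : ∀ j k ω, 0 ≤ D j k ω)
    (hD1 : ∀ j k ω, D j k ω ≤ 1) {d : ℕ → Ω → ℝ} (hd : ∀ k, Measurable (d k))
    (hd0 : ∀ k ω, 0 ≤ d k ω) (hd1 : ∀ k ω, d k ω ≤ 1) {W : Ω → ℝ} (hW : Measurable W)
    (hW0 : ∀ ω, 0 ≤ W ω) (hW1 : ∀ ω, W ω ≤ 1)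
    (hs : Summable fun k => ∫ ω, d k ω * W ω ∂μ)
    (hmean : ∀ j, ∀ k ≤ j, |∫ ω, (D (j + 1) k ω - d k ω) * W ω ∂μ| ≤ (1 / 2) ^ j) :
    Summable fun j : ℕ =>
      (∫ ω, (∑ k ∈ Finset.range j, (D j k ω - d k ω)) ^ 2 * W ω ∂μ) / (j : ℝ) ^ 2 := by
  let a : ℕ → ℝ := fun k => ∫ ω, d k ω * W ω ∂μ
  have ha : ∀ k, 0 ≤ a k := fun k => integral_nonneg fun ω => mul_nonneg (hd0 k ω) (hW0 ω)
  have hDint : ∀ j k, Integrable (fun ω => D j k ω * W ω) μ := fun j k =>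
    integrable_mul_of_mem_unitInterval (hD j k) (hD0 j k) (hD1 j k) hW hW0 hW1
  have hdint : ∀ k, Integrable (fun ω => d k ω * W ω) μ := fun k =>
    integrable_mul_of_mem_unitInterval (hd k) (hd0 k) (hd1 k) hW hW0 hW1
  have hDle : ∀ j, ∀ k ≤ j, ∫ ω, D (j + 1) k ω * W ω ∂μ ≤ a k + (1 / 2) ^ j := fun j k hk =>
    integral_mul_le_add_of_abs_integral_sub_mul_le (hDint _ k) (hdint k) (hmean j k hk)
  have hbound : ∀ j : ℕ,
      ∫ ω, (∑ k ∈ Finset.range (j + 1), (D (j + 1) k ω - d k ω)) ^ 2 * W ω ∂μ ≤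
        4 * ∑ k ∈ Finset.range (j + 1), ((k : ℝ) + 1) * a k +
          2 * ((j : ℝ) + 1) ^ 2 * (1 / 2) ^ j := by
    intro j
    have hpt : ∀ ω, (∑ k ∈ Finset.range (j + 1), (D (j + 1) k ω - d k ω)) ^ 2 * W ω ≤
        ∑ k ∈ Finset.range (j + 1),
          2 * ((k : ℝ) + 1) * (D (j + 1) k ω * W ω + d k ω * W ω) := fun ω => by
      have h1 := sq_sum_range_le (fun k => hD0 (j + 1) k ω) (fun k => hD1 (j + 1) k ω) (j + 1)
      have h2 := sq_sum_range_le (fun k => hd0 k ω) (fun k => hd1 k ω) (j + 1)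
      have h3 := Finset.sum_nonneg fun k (_ : k ∈ Finset.range (j + 1)) => hD0 (j + 1) k ω
      have h4 := Finset.sum_nonneg fun k (_ : k ∈ Finset.range (j + 1)) => hd0 k ω
      rw [Finset.sum_sub_distrib]
      calc _ ≤ (∑ k ∈ Finset.range (j + 1), 2 * ((k : ℝ) + 1) * D (j + 1) k ω +
            ∑ k ∈ Finset.range (j + 1), 2 * ((k : ℝ) + 1) * d k ω) * W ω :=
            mul_le_mul_of_nonneg_right (by nlinarith) (hW0 ω)
        _ = _ := by
            rw [← Finset.sum_add_distrib, Finset.sum_mul]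
            exact Finset.sum_congr rfl fun k _ => by ring
    have hsumint : ∀ k : ℕ, Integrable
        (fun ω => 2 * ((k : ℝ) + 1) * (D (j + 1) k ω * W ω + d k ω * W ω)) μ := fun k =>
      ((hDint _ k).add (hdint k)).const_mul _
    calc _ ≤ ∫ ω, ∑ k ∈ Finset.range (j + 1),
          2 * ((k : ℝ) + 1) * (D (j + 1) k ω * W ω + d k ω * W ω) ∂μ :=
          integral_mono_of_nonneg
            (ae_of_all _ fun ω => mul_nonneg (sq_nonneg _) (hW0 ω))
            (integrable_finsetSum _ fun k _ => hsumint k) (ae_of_all _ hpt)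
      _ = ∑ k ∈ Finset.range (j + 1),
          2 * ((k : ℝ) + 1) * (∫ ω, D (j + 1) k ω * W ω ∂μ + a k) := by
          rw [integral_finsetSum _ fun k _ => hsumint k]
          refine Finset.sum_congr rfl fun k _ => ?_
          rw [integral_const_mul, integral_add (hDint _ k) (hdint k)]
      _ ≤ ∑ k ∈ Finset.range (j + 1),
          (4 * (((k : ℝ) + 1) * a k) + 2 * ((j : ℝ) + 1) * (1 / 2) ^ j) := by
          refine Finset.sum_le_sum fun k hk => ?_
          have hkj : k ≤ j := Nat.lt_succ_iff.1 (Finset.mem_range.1 hk)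
          have hkj' : (k : ℝ) ≤ j := by exact_mod_cast hkj
          have hp : (0 : ℝ) < (1 / 2) ^ j := by positivity
          calc _ ≤ 2 * ((k : ℝ) + 1) * (a k + (1 / 2) ^ j + a k) := by
                gcongr
                exact hDle j k hkj
            _ = 4 * (((k : ℝ) + 1) * a k) + 2 * ((k : ℝ) + 1) * (1 / 2) ^ j := by ring
            _ ≤ _ := by gcongr
      _ = _ := by
          rw [Finset.sum_add_distrib, ← Finset.mul_sum, Finset.sum_const, Finset.card_range,
            nsmul_eq_mul]
          push_cast
          ring
  refine (summable_nat_add_iff 1).1 (Summable.of_nonneg_of_le (fun j => ?_) (fun j => ?_)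
    ((((summable_nat_add_iff 1).2 (summable_sum_range_mul_div_sq ha hs)).mul_left 4).add
      ((summable_add_one_pow_mul_half_pow 0).mul_left 2)))
  · exact div_nonneg (integral_nonneg fun ω => mul_nonneg (sq_nonneg _) (hW0 ω)) (sq_nonneg _)
  · refine (div_le_div_of_nonneg_right (hbound j) (sq_nonneg _)).trans (le_of_eq ?_)
    push_cast
    field_simp

/-- The part of `x` lying between the heights `k` and `k + 1`. -/
noncomputable def layer (k : ℕ) (x : ℝ) : ℝ := min x (k + 1) - min x k

theorem layer_nonneg (k : ℕ) (x : ℝ) : 0 ≤ layer k x :=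
  sub_nonneg.2 (min_le_min_left _ (by linarith))

theorem layer_le_one (k : ℕ) (x : ℝ) : layer k x ≤ 1 := by
  have h : min x ((k : ℝ) + 1) ≤ min x k + 1 := by
    rw [← min_add_add_right]
    exact min_le_min_right _ (by linarith)
  rw [layer]
  linarith

theorem layer_eq_one {k : ℕ} {x : ℝ} (h : (k : ℝ) + 1 ≤ x) : layer k x = 1 := by
  rw [layer, min_eq_right h, min_eq_right (by linarith)]
  ring

theorem measurable_layer (k : ℕ) : Measurable (layer k) :=
  (measurable_id.min measurable_const).sub (measurable_id.min measurable_const)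

theorem sum_range_layer {x : ℝ} (hx : 0 ≤ x) (n : ℕ) :
    ∑ k ∈ Finset.range n, layer k x = min x n := by
  have h := Finset.sum_range_sub (fun k : ℕ => min x (k : ℝ)) n
  simpa [layer, hx] using h

/-- Cesàro means with a finite limit, obtained from the truncations at the index. -/
theorem tendsto_cesaro_of_tendsto_cesaro_truncation {x : ℕ → ℝ} {l : ℝ}
    (h : Tendsto (fun n : ℕ => (∑ j ∈ Finset.range n, min (x j) j) / (n : ℝ)) atTop (𝓝 l))
    (hx : ∀ᶠ j : ℕ in atTop, x j ≤ j) :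
    Tendsto (fun n : ℕ => (∑ j ∈ Finset.range n, x j) / (n : ℝ)) atTop (𝓝 l) := by
  have hzero : Tendsto (fun j : ℕ => x j - min (x j) j) atTop (𝓝 0) :=
    tendsto_const_nhds.congr' (hx.mono fun j hj => by simp [min_eq_left hj])
  have h2 := h.add hzero.cesaro
  rw [add_zero] at h2
  refine h2.congr fun n => ?_
  rw [Finset.sum_sub_distrib]
  ring

/-- Von Weizsäcker's theorem (subsequence version): every sequence of non-negative
random variables has a subsequence `g` such that the Cesàro means of every
subsequence of `g` converge a.e. to a fixed `[0, ∞]`-valued measurable function. -/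
theorem vonWeizsacker_subsequence
    {Ω : Type*} [MeasurableSpace Ω] (μ : Measure Ω) [IsProbabilityMeasure μ]
    (f : ℕ → Ω → ℝ) (hmeas : ∀ n, Measurable (f n)) (hnonneg : ∀ n ω, 0 ≤ f n ω) :
    ∃ (F : Ω → ENNReal), Measurable F ∧ ∃ φ : ℕ → ℕ, StrictMono φ ∧
      ∀ ψ : ℕ → ℕ, StrictMono ψ →
        ∀ᵐ ω ∂μ, Tendsto
          (fun n : ℕ => ENNReal.ofReal ((∑ k ∈ Finset.range n, f (φ (ψ k)) ω) / n))
          atTop (𝓝 (F ω)) := by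
  have hu : ∀ n k, Measurable fun ω => layer k (f n ω) := fun n k =>
    (measurable_layer k).comp (hmeas n)
  obtain ⟨φ₁, hφ₁, d, hd, hd0, hd1, hweak⟩ := exists_subseq_tendsto_integral_mul μ
    (fun n k ω => layer k (f n ω)) hu (fun _ _ _ => layer_nonneg _ _) fun _ _ _ => layer_le_one _ _
  let F : Ω → ENNReal := fun ω => ∑' k, ENNReal.ofReal (d k ω)
  have hF : Measurable F := Measurable.tsum fun k => (hd k).ennreal_ofReal
  -- The weight `w` is positive exactly where `F` is finite, and it makes `F` integrable.
  let w : Ω → ℝ := fun ω => ((1 + F ω)⁻¹).toReal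
  have hw : Measurable w := (measurable_const.add hF).inv.ennreal_toReal
  have hw0 : ∀ ω, 0 ≤ w ω := fun ω => ENNReal.toReal_nonneg
  have hw1 : ∀ ω, w ω ≤ 1 := fun ω =>
    ENNReal.toReal_le_of_le_ofReal zero_le_one (by simp)
  have hwpos : ∀ ω, F ω ≠ ⊤ → 0 < w ω := fun ω hω =>
    ENNReal.toReal_pos (by simp [hω]) (by simp)
  have hofReal : ∀ n ω, ENNReal.ofReal (∑ k ∈ Finset.range n, d k ω) =
      ∑ k ∈ Finset.range n, ENNReal.ofReal (d k ω) := fun n ω =>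
    ENNReal.ofReal_sum_of_nonneg fun k _ => hd0 k ω
  have hHF : ∀ ω, Tendsto (fun n => ENNReal.ofReal (∑ k ∈ Finset.range n, d k ω)) atTop
      (𝓝 (F ω)) := fun ω => by
    simpa only [hofReal] using ENNReal.tendsto_nat_tsum fun k => ENNReal.ofReal (d k ω)
  have hHw : ∀ n ω, (∑ k ∈ Finset.range n, d k ω) * w ω ≤ 1 := fun n ω => by
    by_cases hω : F ω = ⊤
    · simp [w, hω]
    · have hle : ∑ k ∈ Finset.range n, d k ω ≤ (F ω).toReal :=
        (ENNReal.ofReal_le_iff_le_toReal hω).1 ((hofReal n ω).trans_le (ENNReal.sum_le_tsum _))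
      have hFn : 0 ≤ (F ω).toReal := ENNReal.toReal_nonneg
      simp only [w]
      rw [ENNReal.toReal_inv, ENNReal.toReal_add ENNReal.one_ne_top hω, ENNReal.toReal_one,
        ← div_eq_mul_inv, div_le_one (by linarith)]
      linarith
  have hdw : ∀ k, Integrable (fun ω => d k ω * w ω) μ := fun k =>
    integrable_mul_of_mem_unitInterval (hd k) (hd0 k) (hd1 k) hw hw0 hw1
  have hsum : Summable fun k => ∫ ω, d k ω * w ω ∂μ := by
    refine summable_of_sum_range_le (c := 1)
      (fun k => integral_nonneg fun ω => mul_nonneg (hd0 k ω) (hw0 ω)) fun n => ?_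
    rw [← integral_finsetSum _ fun k _ => hdw k]
    calc _ ≤ ∫ _, (1 : ℝ) ∂μ := integral_mono (integrable_finsetSum _ fun k _ => hdw k)
          (integrable_const _) fun ω => by simpa only [Finset.sum_mul] using hHw n ω
      _ = 1 := by simp
  obtain ⟨φ₂, hφ₂, horth⟩ := exists_subseq_almost_orthogonal μ
    (fun n k ω => layer k (f (φ₁ n) ω) - d k ω) (fun n k => (hu _ k).sub (hd k))
    (fun n k ω => abs_sub_le_one (layer_nonneg _ _) (layer_le_one _ _) (hd0 k ω) (hd1 k ω))
    (fun b : Bool => if b then w else fun _ => 1)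
    (fun b => by cases b <;> simp [hw])
    (fun b ω => by cases b <;> simp [abs_of_nonneg (hw0 ω), hw1 ω])
    fun k v hv hv1 => by
      have h := (hweak k v hv 1 hv1).sub_const (∫ ω, d k ω * v ω ∂μ)
      rw [sub_self] at h
      refine h.congr fun n => ?_
      have hint : ∀ {x : Ω → ℝ}, Measurable x → (∀ ω, 0 ≤ x ω) → (∀ ω, x ω ≤ 1) →
          Integrable (fun ω => x ω * v ω) μ := fun {x} hx h0 h1 =>
        integrable_of_measurable_of_abs_le (hx.mul hv) (C := 1) fun ω => by
          rw [abs_mul, abs_of_nonneg (h0 ω)]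
          exact mul_le_one₀ (h1 ω) (abs_nonneg _) (hv1 ω)
      simp only [sub_mul]
      rw [integral_sub (hint (hu _ k) (fun _ => layer_nonneg _ _) fun _ => layer_le_one _ _)
        (hint (hd k) (hd0 k) (hd1 k))]
  refine ⟨F, hF, φ₁ ∘ φ₂, hφ₁.comp hφ₂, fun ψ hψ => ?_⟩
  let g : ℕ → Ω → ℝ := fun j => f (φ₁ (φ₂ (ψ j)))
  have hg0 : ∀ j ω, 0 ≤ g j ω := fun j ω => hnonneg _ ω
  have hD : ∀ j k, Measurable fun ω => layer k (g j ω) := fun j k => hu _ k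
  have hD0 : ∀ j k ω, 0 ≤ layer k (g j ω) := fun _ _ _ => layer_nonneg _ _
  have hD1 : ∀ j k ω, layer k (g j ω) ≤ 1 := fun _ _ _ => layer_le_one _ _
  have hmean : ∀ j, ∀ k ≤ j,
      |∫ ω, (layer k (g (j + 1) ω) - d k ω) * w ω ∂μ| ≤ (1 / 2) ^ j := fun j k hk => by
    simpa using (horth ψ hψ j true k hk).1
  have hfinite := ae_tendsto_cesaro_layers μ hD hD0 hD1 hd hd0 hd1 hw hw0 hw1
    (fun j k hk i hi l hl => by simpa using (horth ψ hψ j true k hk).2 i hi l hl)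
    (L := fun j => j) (fun j => le_rfl)
    (summable_integral_sq_layers_div_sq μ hD hD0 hD1 hd hd0 hd1 hw hw0 hw1 hsum hmean)
  have htail : ∀ᵐ ω ∂μ, Tendsto (fun j => layer j (g (j + 1) ω) * w ω) atTop (𝓝 0) := by
    have hint : ∀ j, Integrable (fun ω => layer j (g (j + 1) ω) * w ω) μ := fun j =>
      integrable_mul_of_mem_unitInterval (hD _ j) (hD0 _ j) (hD1 _ j) hw hw0 hw1
    refine ae_tendsto_zero_of_summable_integral hint
      (fun j ω => mul_nonneg (hD0 _ _ ω) (hw0 ω)) ?_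
    exact Summable.of_nonneg_of_le
      (fun j => integral_nonneg fun ω => mul_nonneg (hD0 _ _ ω) (hw0 ω))
      (fun j => integral_mul_le_add_of_abs_integral_sub_mul_le (hint j) (hdw j)
        (hmean j j le_rfl))
      (hsum.add summable_geometric_two)
  have hinfinite := ae_all_iff.2 fun K : ℕ =>
    ae_tendsto_cesaro_layers μ hD hD0 hD1 hd hd0 hd1 (W := fun _ => 1) measurable_const
      (fun _ => zero_le_one) (fun _ => le_rfl)
      (fun j k hk i hi l hl => by simpa using (horth ψ hψ j false k hk).2 i hi l hl)
      (L := fun j => min j K) (fun j => min_le_left _ _) (by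
        refine Summable.of_nonneg_of_le (fun j => div_nonneg (integral_nonneg fun ω =>
          mul_nonneg (sq_nonneg _) zero_le_one) (sq_nonneg _)) (fun j => ?_)
          ((Real.summable_nat_pow_inv.2 one_lt_two).mul_left ((K : ℝ) ^ 2))
        rw [← div_eq_mul_inv]
        refine div_le_div_of_nonneg_right ?_ (sq_nonneg _)
        calc _ ≤ ∫ _, (K : ℝ) ^ 2 ∂μ := by
              refine integral_mono_of_nonneg (ae_of_all _ fun ω =>
                mul_nonneg (sq_nonneg _) zero_le_one) (integrable_const _)
                (ae_of_all _ fun ω => ?_)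
              simp only [mul_one]
              rw [sq_le_sq, Nat.abs_cast]
              calc _ ≤ ∑ k ∈ Finset.range (min j K), |layer k (g j ω) - d k ω| :=
                    Finset.abs_sum_le_sum_abs _ _
                _ ≤ ∑ k ∈ Finset.range (min j K), (1 : ℝ) := Finset.sum_le_sum fun k _ =>
                    abs_sub_le_one (hD0 _ _ _) (hD1 _ _ _) (hd0 _ _) (hd1 _ _)
                _ ≤ K := by simp
          _ = (K : ℝ) ^ 2 := by simp)
  filter_upwards [hfinite, htail, hinfinite] with ω h1 h2 h3
  by_cases hω : F ω = ⊤
  · rw [hω]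
    refine ENNReal.tendsto_ofReal_nhds_top.2 (tendsto_atTop.2 fun b => ?_)
    obtain ⟨K, hK⟩ : ∃ K, b < ∑ k ∈ Finset.range K, d k ω := by
      have h := hHF ω
      rw [hω] at h
      exact ((ENNReal.tendsto_ofReal_nhds_top.1 h).eventually_gt_atTop b).exists
    have hlim := h3 K zero_lt_one (∑ k ∈ Finset.range K, d k ω)
      (tendsto_const_nhds.congr' ((eventually_ge_atTop K).mono fun j hj => by
        simp only [min_eq_right hj]))
    filter_upwards [hlim.eventually_const_lt hK] with n hn
    refine hn.le.trans (div_le_div_of_nonneg_right (Finset.sum_le_sum fun j _ => ?_)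
      (Nat.cast_nonneg n))
    rw [sum_range_layer (hg0 j ω)]
    exact min_le_left _ _
  · have hlim := (ENNReal.tendsto_toReal hω).comp (hHF ω)
    simp only [Function.comp_def,
      ENNReal.toReal_ofReal (Finset.sum_nonneg fun k _ => hd0 k ω)] at hlim
    have hY := h1 (hwpos ω hω) _ hlim
    simp only [sum_range_layer (hg0 _ ω)] at hY
    rw [← ENNReal.ofReal_toReal hω]
    refine ENNReal.tendsto_ofReal (tendsto_cesaro_of_tendsto_cesaro_truncation hY ?_)
    have hev : ∀ᶠ j : ℕ in atTop, g (j + 1) ω ≤ ((j + 1 : ℕ) : ℝ) := by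
      filter_upwards [h2.eventually_lt_const (hwpos ω hω)] with j hj
      by_contra! hlt
      rw [layer_eq_one (by exact_mod_cast hlt.le), one_mul] at hj
      exact lt_irrefl _ hj
    rw [← map_add_atTop_eq_nat 1]
    exact eventually_map.2 hev
end

section
/- Komlós' theorem: Let (Ω, Σ, μ) be a probability space and (f_n)_{n≥1} a sequence of real-valued integrable functions with sup_n ∫ |f_n| dμ < ∞. Then there exist f ∈ L¹(μ) and a strictly increasing map φ : ℕ → ℕ such that, setting g_n = f_{φ(n)}, for every strictly increasing map ψ : ℕ → ℕ the Cesàro means (1/n) ∑_{k=1}^n g_{ψ(k)}(ω) converge to f(ω) for μ-almost every ω ∈ Ω. -/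
open MeasureTheory Filter Topology

open scoped ENNReal InnerProductSpace

/-- A bounded real sequence converges along every ultrafilter. -/
theorem Ultrafilter.exists_tendsto_of_mem_Icc {ι : Type*} (U : Ultrafilter ι) {u : ι → ℝ} {a b : ℝ}
    (hu : ∀ n, u n ∈ Set.Icc a b) : ∃ l ∈ Set.Icc a b, Tendsto u U (𝓝 l) :=
  isCompact_Icc.ultrafilter_le_nhds (U.map u) (by
    rw [le_principal_iff]
    exact Filter.mem_map.2 (Eventually.of_forall hu))

/-- A bounded sequence in a Hilbert space converges weakly along every ultrafilter. -/
theorem Ultrafilter.exists_tendsto_inner {ι H : Type*} [NormedAddCommGroup H]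
    [InnerProductSpace ℝ H] [CompleteSpace H] (U : Ultrafilter ι) {x : ι → H} {M : ℝ}
    (hx : ∀ n, ‖x n‖ ≤ M) :
    ∃ b : H, ∀ y : H, Tendsto (fun n => ⟪x n, y⟫_ℝ) U (𝓝 ⟪b, y⟫_ℝ) := by
  let d : ι → WeakDual ℝ H := fun n =>
    StrongDual.toWeakDual (InnerProductSpace.toDual ℝ H (x n))
  obtain ⟨l, -, hl⟩ := (WeakDual.isCompact_closedBall (𝕜 := ℝ) (E := H) 0 M).ultrafilter_le_nhds
    (U.map d) (by
      rw [le_principal_iff]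
      refine Filter.mem_map.2 (Eventually.of_forall fun n => ?_)
      simpa [d] using hx n)
  refine ⟨(InnerProductSpace.toDual ℝ H).symm (WeakDual.toStrongDual l), fun y => ?_⟩
  have h := ((WeakDual.eval_continuous (𝕜 := ℝ) y).tendsto l).comp hl
  rw [InnerProductSpace.toDual_symm_apply]
  exact h

/-- Limits along an ultrafilter of nonnegative sequences with uniformly bounded sums form a
summable family. -/
theorem Ultrafilter.exists_summable_tendsto {ι : Type*} (U : Ultrafilter ι) {a : ℕ → ι → ℝ} {C : ℝ}
    (ha : ∀ k n, 0 ≤ a k n) (hC : ∀ K n, ∑ k ∈ Finset.range K, a k n ≤ C) :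
    ∃ s : ℕ → ℝ, (∀ k, 0 ≤ s k) ∧ Summable s ∧ ∀ k, Tendsto (a k) U (𝓝 (s k)) := by
  have hmem (k : ℕ) (n : ι) : a k n ∈ Set.Icc 0 C :=
    ⟨ha k n, (Finset.single_le_sum (fun i _ => ha i n) (Finset.self_mem_range_succ k)).trans
      (hC (k + 1) n)⟩
  choose s hs hlim using fun k => U.exists_tendsto_of_mem_Icc (hmem k)
  refine ⟨s, fun k => (hs k).1, summable_of_sum_range_le (c := C) (fun k => (hs k).1) fun K => ?_,
    hlim⟩
  exact le_of_tendsto (tendsto_finsetSum _ fun k _ => hlim k) (Eventually.of_forall (hC K))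

/-- Recursive extraction: each term satisfies a condition that depends on a bound for the
previous terms. -/
theorem Filter.exists_strictMono_of_forall_eventually {l : Filter ℕ} [l.NeBot] (hl : l ≤ atTop)
    {p : ℕ → ℕ → Prop} (hp : ∀ x, ∀ᶠ y in l, p x y) :
    ∃ φ x : ℕ → ℕ, StrictMono φ ∧ (∀ m, m ≤ x m) ∧ (∀ i m, i < m → φ i ≤ x m) ∧
      ∀ m, p (x m) (φ m) := by
  choose g hg using fun x => ((hp x).and (hl (eventually_gt_atTop x))).exists
  have hx : StrictMono fun m => g^[m] 0 := strictMono_nat_of_lt_succ fun m => by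
    rw [Function.iterate_succ_apply']
    exact (hg _).2
  refine ⟨fun m => g^[m + 1] 0, fun m => g^[m] 0, fun i j hij => hx (Nat.succ_lt_succ hij),
    fun m => hx.le_apply, fun i m him => hx.monotone him, fun m => ?_⟩
  simp only [Function.iterate_succ_apply']
  exact (hg _).1

/-- Almost orthogonal vectors satisfy an approximate Pythagorean inequality. -/
theorem norm_sum_range_sq_le {H : Type*} [NormedAddCommGroup H] [InnerProductSpace ℝ H]
    {Y : ℕ → H} {w : ℕ → ℝ} (hw : ∀ k, ‖Y k‖ ^ 2 ≤ w k)
    (hY : ∀ j k, j < k → |⟪Y j, Y k⟫_ℝ| ≤ 1 / (k + 1)) (n : ℕ) :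
    ‖∑ k ∈ Finset.range n, Y k‖ ^ 2 ≤ ∑ k ∈ Finset.range n, (w k + 2) := by
  induction n with
  | zero => simp
  | succ n ih =>
    have hcross : ⟪∑ k ∈ Finset.range n, Y k, Y n⟫_ℝ ≤ 1 := by
      rw [sum_inner]
      calc ∑ k ∈ Finset.range n, ⟪Y k, Y n⟫_ℝ
          ≤ ∑ _k ∈ Finset.range n, (1 / ((n : ℝ) + 1)) :=
            Finset.sum_le_sum fun k hk => (le_abs_self _).trans (hY k n (Finset.mem_range.1 hk))
        _ = n / ((n : ℝ) + 1) := by simp [div_eq_mul_inv]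
        _ ≤ 1 := by rw [div_le_one (by positivity)]; linarith
    rw [Finset.sum_range_succ, Finset.sum_range_succ, norm_add_sq_real]
    linarith [hw n]

/-- The limit of an a.e. monotone sequence of functions with bounded integrals exists a.e. and is
integrable. -/
theorem exists_integrable_ae_tendsto_of_monotone {Ω : Type*} [MeasurableSpace Ω] {μ : Measure Ω}
    {β : ℕ → Ω → ℝ} {C : ℝ} (hint : ∀ k, Integrable (β k) μ) (hnn : ∀ k, 0 ≤ᵐ[μ] β k)
    (hmono : ∀ᵐ ω ∂μ, Monotone fun k => β k ω) (hC : ∀ k, ∫ ω, β k ω ∂μ ≤ C) :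
    ∃ F : Ω → ℝ, Integrable F μ ∧ ∀ᵐ ω ∂μ, Tendsto (fun k => β k ω) atTop (𝓝 (F ω)) := by
  have hmeas (k : ℕ) : AEMeasurable (fun ω => ENNReal.ofReal (β k ω)) μ :=
    (hint k).aemeasurable.ennreal_ofReal
  have hle : ∫⁻ ω, ⨆ k, ENNReal.ofReal (β k ω) ∂μ ≤ ENNReal.ofReal C := by
    rw [lintegral_iSup' hmeas
      (hmono.mono fun ω h i j hij => ENNReal.ofReal_le_ofReal (h hij))]
    refine iSup_le fun k => ?_
    rw [← ofReal_integral_eq_lintegral_ofReal (hint k) (hnn k)]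
    exact ENNReal.ofReal_le_ofReal (hC k)
  have hne : ∫⁻ ω, ⨆ k, ENNReal.ofReal (β k ω) ∂μ ≠ ∞ := (hle.trans_lt ENNReal.ofReal_lt_top).ne
  have hsup : AEMeasurable (fun ω => ⨆ k, ENNReal.ofReal (β k ω)) μ := AEMeasurable.iSup hmeas
  refine ⟨fun ω => (⨆ k, ENNReal.ofReal (β k ω)).toReal,
    integrable_toReal_of_lintegral_ne_top hsup hne, ?_⟩
  filter_upwards [ae_lt_top' hsup hne, hmono, ae_all_iff.2 hnn] with ω hfin hm h0
  have ht := (ENNReal.tendsto_toReal hfin.ne).comp (tendsto_atTop_iSup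
    fun i j hij => ENNReal.ofReal_le_ofReal (hm hij) :
      Tendsto (fun k => ENNReal.ofReal (β k ω)) atTop _)
  exact ht.congr fun k => ENNReal.toReal_ofReal (h0 k)

/-- Functions in `L²` with summable squared norms tend to zero a.e. -/
theorem ae_tendsto_zero_of_summable_norm_sq {Ω : Type*} [MeasurableSpace Ω] {μ : Measure Ω}
    {D : ℕ → Lp ℝ 2 μ} (hD : Summable fun i => ‖D i‖ ^ 2) :
    ∀ᵐ ω ∂μ, Tendsto (fun i => D i ω) atTop (𝓝 0) := by
  have hmeas (i : ℕ) : AEMeasurable (fun ω => ENNReal.ofReal (D i ω ^ 2)) μ :=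
    ((Lp.aestronglyMeasurable (D i)).aemeasurable.pow_const 2).ennreal_ofReal
  have hterm (i : ℕ) : ∫⁻ ω, ENNReal.ofReal (D i ω ^ 2) ∂μ = ENNReal.ofReal (‖D i‖ ^ 2) := by
    rw [← ofReal_integral_eq_lintegral_ofReal (Lp.memLp (D i)).integrable_sq
      (Eventually.of_forall fun ω => sq_nonneg _), ← real_inner_self_eq_norm_sq, L2.inner_def]
    simp [pow_two]
  have hne : ∫⁻ ω, ∑' i, ENNReal.ofReal (D i ω ^ 2) ∂μ ≠ ∞ := by
    rw [lintegral_tsum hmeas]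
    simp_rw [hterm]
    exact hD.tsum_ofReal_ne_top
  filter_upwards [ae_lt_top' (AEMeasurable.tsum hmeas) hne] with ω hω
  have h := (ENNReal.tendsto_toReal ENNReal.zero_ne_top).comp
    (ENNReal.tendsto_atTop_zero_of_tsum_ne_top hω.ne)
  have h2 : Tendsto (fun i => D i ω ^ 2) atTop (𝓝 0) := by
    refine h.congr fun i => ENNReal.toReal_ofReal (sq_nonneg _)
  have h3 := h2.sqrt
  rw [Real.sqrt_zero] at h3
  rw [tendsto_zero_iff_abs_tendsto_zero]
  exact h3.congr fun i => Real.sqrt_sq_eq_abs _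

theorem summable_sum_div_floor_pow_sq {w : ℕ → ℝ} (hw : ∀ k, 0 ≤ w k)
    (hsum : Summable fun k : ℕ => w k / ((k : ℝ) + 1) ^ 2) {c : ℝ} (hc : 1 < c) :
    Summable fun i : ℕ => (∑ k ∈ Finset.range ⌊c ^ i⌋₊, w k) / (⌊c ^ i⌋₊ : ℝ) ^ 2 := by
  set A : ℝ := c ^ 5 * (c - 1)⁻¹ ^ 3 with hA
  have hA0 : 0 ≤ A := by
    have := sub_pos.2 hc
    positivity
  refine summable_of_sum_range_le (c := 4 * A * ∑' k : ℕ, w k / ((k : ℝ) + 1) ^ 2)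
    (fun i => div_nonneg (Finset.sum_nonneg fun k _ => hw k) (sq_nonneg _)) fun N => ?_
  obtain ⟨M, hM⟩ : ∃ M : ℕ, ∀ i < N, ⌊c ^ i⌋₊ ≤ M :=
    ⟨⌊c ^ N⌋₊, fun i hi => Nat.floor_le_floor (pow_le_pow_right₀ hc.le hi.le)⟩
  calc ∑ i ∈ Finset.range N, (∑ k ∈ Finset.range ⌊c ^ i⌋₊, w k) / (⌊c ^ i⌋₊ : ℝ) ^ 2
      = ∑ i ∈ Finset.range N, ∑ k ∈ Finset.range M,
          if k < ⌊c ^ i⌋₊ then w k * (1 / (⌊c ^ i⌋₊ : ℝ) ^ 2) else 0 := by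
        refine Finset.sum_congr rfl fun i hi => ?_
        rw [← Finset.sum_filter, Finset.sum_div]
        refine Finset.sum_congr ?_ fun k _ => by ring
        ext k
        have := hM i (Finset.mem_range.1 hi)
        simp only [Finset.mem_range, Finset.mem_filter]
        omega
    _ = ∑ k ∈ Finset.range M, w k *
          ∑ i ∈ Finset.range N with k < ⌊c ^ i⌋₊, 1 / (⌊c ^ i⌋₊ : ℝ) ^ 2 := by
        rw [Finset.sum_comm]
        refine Finset.sum_congr rfl fun k _ => ?_
        rw [Finset.mul_sum, Finset.sum_filter]
    _ ≤ ∑ k ∈ Finset.range M, w k * (A / (((k : ℝ) + 1) / 2) ^ 2) := by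
        refine Finset.sum_le_sum fun k _ => mul_le_mul_of_nonneg_left ?_ (hw k)
        refine le_trans (Finset.sum_le_sum_of_subset_of_nonneg ?_ fun i _ _ => by positivity)
          (sum_div_nat_floor_pow_sq_le_div_sq N (j := ((k : ℝ) + 1) / 2) (by positivity) hc)
        intro i hi
        simp only [Finset.mem_filter] at hi ⊢
        refine ⟨hi.1, ?_⟩
        have h1 : (k : ℝ) + 1 ≤ ⌊c ^ i⌋₊ := by exact_mod_cast hi.2
        have h2 : (0 : ℝ) < (k : ℝ) + 1 := by positivity
        linarith
    _ = 4 * A * ∑ k ∈ Finset.range M, w k / ((k : ℝ) + 1) ^ 2 := by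
        rw [Finset.mul_sum]
        refine Finset.sum_congr rfl fun k _ => ?_
        field_simp
        ring
    _ ≤ 4 * A * ∑' k : ℕ, w k / ((k : ℝ) + 1) ^ 2 :=
        mul_le_mul_of_nonneg_left
          (hsum.sum_le_tsum _ fun k _ => div_nonneg (hw k) (sq_nonneg _)) (by positivity)

/-- Averages of almost orthogonal functions tend to zero a.e. along geometric subsequences. -/
theorem ae_tendsto_sum_div_floor_pow {Ω : Type*} [MeasurableSpace Ω] {μ : Measure Ω}
    {Y : ℕ → Lp ℝ 2 μ} {w : ℕ → ℝ} (hw : ∀ k, 0 ≤ w k)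
    (hY : ∀ n, ‖∑ k ∈ Finset.range n, Y k‖ ^ 2 ≤ ∑ k ∈ Finset.range n, w k)
    (hsum : Summable fun k : ℕ => w k / ((k : ℝ) + 1) ^ 2) {c : ℝ} (hc : 1 < c) :
    ∀ᵐ ω ∂μ, Tendsto (fun i : ℕ => (∑ k ∈ Finset.range ⌊c ^ i⌋₊, Y k ω) / (⌊c ^ i⌋₊ : ℝ))
      atTop (𝓝 0) := by
  let D : ℕ → Lp ℝ 2 μ := fun i => (⌊c ^ i⌋₊ : ℝ)⁻¹ • ∑ k ∈ Finset.range ⌊c ^ i⌋₊, Y k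
  have hD : Summable fun i => ‖D i‖ ^ 2 := by
    refine Summable.of_nonneg_of_le (fun i => sq_nonneg _) (fun i => ?_)
      (summable_sum_div_floor_pow_sq hw hsum hc)
    rw [norm_smul, mul_pow, norm_inv, inv_pow, Real.norm_natCast, div_eq_inv_mul]
    exact mul_le_mul_of_nonneg_left (hY _) (by positivity)
  have hcoe : ∀ᵐ ω ∂μ, ∀ i, D i ω = (∑ k ∈ Finset.range ⌊c ^ i⌋₊, Y k ω) / (⌊c ^ i⌋₊ : ℝ) := by
    refine ae_all_iff.2 fun i => ?_
    filter_upwards [Lp.coeFn_smul (⌊c ^ i⌋₊ : ℝ)⁻¹ (∑ k ∈ Finset.range ⌊c ^ i⌋₊, Y k),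
      Lp.coeFn_finsetSum (Finset.range ⌊c ^ i⌋₊) Y] with ω h1 h2
    simp only [D, h1, Pi.smul_apply, h2, smul_eq_mul, Finset.sum_apply]
    ring
  filter_upwards [ae_tendsto_zero_of_summable_norm_sq hD, hcoe] with ω h1 h2
  exact h1.congr h2

theorem summable_one_div_nat_add_one_sq : Summable fun k : ℕ => 1 / ((k : ℝ) + 1) ^ 2 := by
  exact_mod_cast (summable_nat_add_iff 1).2
    (Real.summable_one_div_nat_pow.2 (one_lt_two : 1 < 2))

/-- The truncation of a function at level `k`, as an element of `L²`. -/
noncomputable def truncationLp {Ω : Type*} [MeasurableSpace Ω] {μ : Measure Ω} [IsFiniteMeasure μ]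
    {f : Ω → ℝ} (hf : Integrable f μ) (k : ℕ) : Lp ℝ 2 μ :=
  (hf.aestronglyMeasurable.memLp_truncation (A := (k : ℝ)) (p := 2)).toLp

section Truncation

open ProbabilityTheory

theorem truncation_mono {Ω : Type*} {f : Ω → ℝ} (hf : 0 ≤ f) {a b : ℝ} (hab : a ≤ b) (ω : Ω) :
    truncation f a ω ≤ truncation f b ω := by
  rw [truncation_eq_of_nonneg hf, truncation_eq_of_nonneg hf]
  simp only [Function.comp_apply, Set.indicator_apply, Set.mem_Ioc, id]
  split_ifs with ha hb hb
  · exact le_rfl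
  · exact absurd ⟨ha.1, ha.2.trans hab⟩ hb
  · exact hf ω
  · exact le_rfl

variable {Ω : Type*} [MeasurableSpace Ω] {μ : Measure Ω} [IsProbabilityMeasure μ]

theorem coeFn_truncationLp {f : Ω → ℝ} (hf : Integrable f μ) (k : ℕ) :
    truncationLp hf k =ᵐ[μ] truncation f k :=
  MemLp.coeFn_toLp _

theorem norm_truncationLp_sq {f : Ω → ℝ} (hf : Integrable f μ) (k : ℕ) :
    ‖truncationLp hf k‖ ^ 2 = ∫ ω, truncation f k ω ^ 2 ∂μ := by
  rw [← real_inner_self_eq_norm_sq, L2.inner_def]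
  refine integral_congr_ae ?_
  filter_upwards [coeFn_truncationLp hf k] with ω h
  simp [h, pow_two]

theorem norm_truncationLp_le {f : Ω → ℝ} (hf : Integrable f μ) (k : ℕ) :
    ‖truncationLp hf k‖ ≤ k := by
  refine abs_le_of_sq_le_sq' ?_ (Nat.cast_nonneg k) |>.2
  rw [norm_truncationLp_sq]
  calc ∫ ω, truncation f k ω ^ 2 ∂μ ≤ ∫ _ω, (k : ℝ) ^ 2 ∂μ := by
        refine integral_mono (hf.aestronglyMeasurable.memLp_truncation (p := 2)).integrable_sq
          (integrable_const _) fun ω => ?_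
        exact sq_le_sq.2 (abs_truncation_le_bound f k ω)
    _ = (k : ℝ) ^ 2 := by simp

theorem sum_truncationLp_le {f : Ω → ℝ} (hf : Integrable f μ) (hnn : 0 ≤ f) (K : ℕ) :
    ∑ k ∈ Finset.range K, ((k : ℝ) ^ 2)⁻¹ * ‖truncationLp hf k‖ ^ 2 ≤ 2 * ∫ ω, f ω ∂μ := by
  let _ : MeasureSpace Ω := ⟨μ⟩
  simp_rw [norm_truncationLp_sq]
  exact sum_variance_truncation_le hf hnn K

theorem sum_measureReal_gt_le {f : Ω → ℝ} (hf : Integrable f μ) (hnn : 0 ≤ f) (K : ℕ) :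
    ∑ k ∈ Finset.range K, μ.real {ω | (k : ℝ) < f ω} ≤ ∫ ω, f ω ∂μ + 1 := by
  have hms (k : ℕ) : NullMeasurableSet {ω | (k : ℝ) < f ω} μ :=
    nullMeasurableSet_lt aemeasurable_const hf.aemeasurable
  have hpt (x : ℝ) (hx : 0 ≤ x) :
      ∑ k ∈ Finset.range K, (if (k : ℝ) < x then (1 : ℝ) else 0) ≤ x + 1 := by
    rw [← Finset.sum_filter, Finset.sum_const, nsmul_one]
    have hsub : (Finset.range K).filter (fun k : ℕ => (k : ℝ) < x) ⊆ Finset.range ⌈x⌉₊ := by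
      intro k hk
      exact Finset.mem_range.2 (Nat.lt_ceil.2 (Finset.mem_filter.1 hk).2)
    have hcard : (((Finset.range K).filter (fun k : ℕ => (k : ℝ) < x)).card : ℝ) ≤ ⌈x⌉₊ := by
      exact_mod_cast (Finset.card_le_card hsub).trans (Finset.card_range _).le
    exact hcard.trans (Nat.ceil_lt_add_one hx).le
  have hind (k : ℕ) : Integrable ({ω | (k : ℝ) < f ω}.indicator fun _ => (1 : ℝ)) μ :=
    (integrable_const 1).indicator₀ (hms k)
  calc ∑ k ∈ Finset.range K, μ.real {ω | (k : ℝ) < f ω}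
      = ∫ ω, ∑ k ∈ Finset.range K, {ω | (k : ℝ) < f ω}.indicator (fun _ => (1 : ℝ)) ω ∂μ := by
        rw [integral_finsetSum _ fun k _ => hind k]
        refine Finset.sum_congr rfl fun k _ => ?_
        rw [integral_indicator₀ (hms k)]
        simp
    _ ≤ ∫ ω, (f ω + 1) ∂μ := by
        refine integral_mono (integrable_finsetSum _ fun k _ => hind k)
          (hf.add (integrable_const 1)) fun ω => ?_
        simpa [Set.indicator_apply] using hpt (f ω) (hnn ω)
    _ = ∫ ω, f ω ∂μ + 1 := by
        rw [integral_add hf (integrable_const 1)]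
        simp

/-- Weak limits of truncations along an ultrafilter increase to an integrable function. -/
theorem exists_weakLimit_truncationLp {ι : Type*} (U : Ultrafilter ι) {f : ι → Ω → ℝ} {C : ℝ}
    (hint : ∀ n, Integrable (f n) μ) (hnn : ∀ n, 0 ≤ f n) (hC : ∀ n, ∫ ω, f n ω ∂μ ≤ C) :
    ∃ (b : ℕ → Lp ℝ 2 μ) (F : Ω → ℝ), Integrable F μ ∧
      (∀ k y, Tendsto (fun n => ⟪truncationLp (hint n) k, y⟫_ℝ) U (𝓝 ⟪b k, y⟫_ℝ)) ∧
      ∀ᵐ ω ∂μ, Tendsto (fun k => b k ω) atTop (𝓝 (F ω)) := by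
  choose b hb using fun k => U.exists_tendsto_inner fun n => norm_truncationLp_le (hint n) k
  have hset (k : ℕ) {s : Set Ω} (hs : MeasurableSet s) :
      Tendsto (fun n => ∫ ω in s, truncation (f n) k ω ∂μ) U (𝓝 (∫ ω in s, b k ω ∂μ)) := by
    have h := hb k (indicatorConstLp 2 hs (measure_ne_top μ s) 1)
    simp_rw [real_inner_comm (indicatorConstLp 2 hs (measure_ne_top μ s) (1 : ℝ)),
      L2.inner_indicatorConstLp_one] at h
    refine h.congr fun n => ?_
    exact integral_congr_ae (ae_restrict_of_ae (coeFn_truncationLp (hint n) k))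
  have hbint (k : ℕ) : Integrable (b k) μ := (Lp.memLp (b k)).integrable one_le_two
  have htint (n : ι) (k : ℕ) : Integrable (truncation (f n) k) μ :=
    (hint n).aestronglyMeasurable.integrable_truncation
  have hbnn (k : ℕ) : 0 ≤ᵐ[μ] b k :=
    ae_nonneg_of_forall_setIntegral_nonneg (hbint k) fun s hs _ =>
      ge_of_tendsto (hset k hs) (Eventually.of_forall fun n =>
        integral_nonneg fun ω => truncation_nonneg _ (hnn n ω))
  have hbmono : ∀ᵐ ω ∂μ, Monotone fun k => b k ω := by
    have h (k : ℕ) : b k ≤ᵐ[μ] b (k + 1) :=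
      ae_le_of_forall_setIntegral_le (hbint k) (hbint (k + 1)) fun s hs _ =>
        le_of_tendsto_of_tendsto' (hset k hs) (hset (k + 1) hs) fun n =>
          integral_mono (htint n k).integrableOn (htint n (k + 1)).integrableOn
            (truncation_mono (hnn n) (by simp))
    filter_upwards [ae_all_iff.2 h] with ω hω
    exact monotone_nat_of_le_succ hω
  have hbC (k : ℕ) : ∫ ω, b k ω ∂μ ≤ C := by
    have h := hset k MeasurableSet.univ
    simp only [Measure.restrict_univ] at h
    exact le_of_tendsto h (Eventually.of_forall fun n =>
      (integral_truncation_le_integral_of_nonneg (hint n) (hnn n)).trans (hC n))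
  obtain ⟨F, hF, hlim⟩ := exists_integrable_ae_tendsto_of_monotone hbint hbnn hbmono hbC
  exact ⟨b, F, hF, hb, hlim⟩

/-- A strong law of large numbers for nonnegative functions whose centered truncations are almost
orthogonal. -/
theorem ae_tendsto_average_of_almost_orthogonal {g : ℕ → Ω → ℝ} (hint : ∀ k, Integrable (g k) μ)
    (hnn : ∀ k, 0 ≤ g k) {b : ℕ → Lp ℝ 2 μ} {F : Ω → ℝ}
    (hb : ∀ᵐ ω ∂μ, Tendsto (fun k => b k ω) atTop (𝓝 (F ω)))
    {q w : ℕ → ℝ} (hq : Summable q) (hgq : ∀ k : ℕ, μ.real {ω | (k : ℝ) < g k ω} ≤ q k)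
    (hw : ∀ k, ‖truncationLp (hint k) k - b k‖ ^ 2 ≤ w k)
    (hsum : Summable fun k : ℕ => w k / ((k : ℝ) + 1) ^ 2)
    (horth : ∀ j k, j < k →
      |⟪truncationLp (hint j) j - b j, truncationLp (hint k) k - b k⟫_ℝ| ≤ 1 / (k + 1)) :
    ∀ᵐ ω ∂μ, Tendsto (fun n : ℕ => (∑ k ∈ Finset.range n, g k ω) / n) atTop (𝓝 (F ω)) := by
  have hw0 (k : ℕ) : 0 ≤ w k := (sq_nonneg _).trans (hw k)
  have hsum2 : Summable fun k : ℕ => (w k + 2) / ((k : ℝ) + 1) ^ 2 := by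
    refine (hsum.add (summable_one_div_nat_add_one_sq.mul_left 2)).congr fun k => ?_
    ring
  obtain ⟨c, -, hc1, hclim⟩ := exists_seq_strictAnti_tendsto (1 : ℝ)
  have hD := ae_all_iff.2 fun i => ae_tendsto_sum_div_floor_pow
    (fun k => add_nonneg (hw0 k) zero_le_two) (norm_sum_range_sq_le hw horth) hsum2 (hc1 i)
  have hcoe : ∀ᵐ ω ∂μ, ∀ k : ℕ,
      (truncationLp (hint k) k - b k : Lp ℝ 2 μ) ω = truncation (g k) k ω - b k ω := by
    refine ae_all_iff.2 fun k => ?_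
    filter_upwards [Lp.coeFn_sub (truncationLp (hint k) k) (b k),
      coeFn_truncationLp (hint k) k] with ω h1 h2
    rw [h1, Pi.sub_apply, h2]
  have hBC : ∀ᵐ ω ∂μ, ∀ᶠ k : ℕ in atTop, ω ∉ {ω | (k : ℝ) < g k ω} := by
    refine ae_eventually_notMem ?_
    refine ne_top_of_le_ne_top hq.tsum_ofReal_ne_top (ENNReal.tsum_le_tsum fun k => ?_)
    rw [← ofReal_measureReal]
    exact ENNReal.ofReal_le_ofReal (hgq k)
  filter_upwards [hb, hD, hcoe, hBC] with ω hbω hDω hcω hBω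
  have htrunc : Tendsto (fun n : ℕ => (∑ k ∈ Finset.range n, truncation (g k) k ω) / n)
      atTop (𝓝 (F ω)) := by
    refine tendsto_div_of_monotone_of_tendsto_div_floor_pow
      (fun n => ∑ k ∈ Finset.range n, truncation (g k) k ω) (F ω) ?_ c hc1 hclim fun i => ?_
    · exact monotone_nat_of_le_succ fun n => by
        rw [Finset.sum_range_succ]
        exact le_add_of_nonneg_right (truncation_nonneg _ (hnn n ω))
    · have h := (hDω i).add (hbω.cesaro.comp
        (tendsto_nat_floor_atTop.comp (tendsto_pow_atTop_atTop_of_one_lt (hc1 i))))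
      rw [zero_add] at h
      refine h.congr fun n => ?_
      simp only [Function.comp_apply, hcω, Finset.sum_sub_distrib]
      ring
  have hdiff : Tendsto (fun k : ℕ => g k ω - truncation (g k) k ω) atTop (𝓝 0) := by
    refine tendsto_const_nhds.congr' ?_
    filter_upwards [hBω] with k hk
    have hk' : g k ω ≤ k := not_lt.1 hk
    rw [truncation_eq_of_nonneg (hnn k), Function.comp_apply]
    rcases (hnn k ω).eq_or_lt with h0 | h0
    · rw [Pi.zero_apply] at h0
      simp [← h0]
    · rw [Set.indicator_of_mem (show g k ω ∈ Set.Ioc 0 (k : ℝ) from ⟨h0, hk'⟩)]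
      simp
  have h := htrunc.add hdiff.cesaro
  rw [add_zero] at h
  refine h.congr fun n => ?_
  rw [Finset.sum_sub_distrib]
  ring

/-- Komlós' theorem for nonnegative functions. -/
theorem komlos_of_nonneg {f : ℕ → Ω → ℝ} {C : ℝ} (hint : ∀ n, Integrable (f n) μ)
    (hnn : ∀ n, 0 ≤ f n) (hC : ∀ n, ∫ ω, f n ω ∂μ ≤ C) :
    ∃ F : Ω → ℝ, Integrable F μ ∧ ∃ φ : ℕ → ℕ, StrictMono φ ∧
      ∀ ψ : ℕ → ℕ, StrictMono ψ → ∀ᵐ ω ∂μ, Tendsto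
        (fun n : ℕ => (∑ k ∈ Finset.range n, f (φ (ψ k)) ω) / n) atTop (𝓝 (F ω)) := by
  let U : Ultrafilter ℕ := hyperfilter ℕ
  have hU : (U : Filter ℕ) ≤ atTop := Nat.hyperfilter_le_atTop
  obtain ⟨b, F, hF, hweak, hlim⟩ := exists_weakLimit_truncationLp U hint hnn hC
  obtain ⟨s, hs0, hs, hslim⟩ := U.exists_summable_tendsto
    (a := fun k n => ((k : ℝ) ^ 2)⁻¹ * ‖truncationLp (hint n) k‖ ^ 2) (C := 2 * C)
    (fun k n => by positivity)
    (fun K n => (sum_truncationLp_le (hint n) (hnn n) K).trans (by linarith [hC n]))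
  obtain ⟨q, -, hq, hqlim⟩ := U.exists_summable_tendsto
    (a := fun k n => μ.real {ω | (k : ℝ) < f n ω}) (C := C + 1)
    (fun k n => measureReal_nonneg)
    (fun K n => (sum_measureReal_gt_le (hint n) (hnn n) K).trans (by linarith [hC n]))
  let Z : ℕ → ℕ → Lp ℝ 2 μ := fun k n => truncationLp (hint n) k - b k
  have hZ (k : ℕ) (y : Lp ℝ 2 μ) : Tendsto (fun n => ⟪y, Z k n⟫_ℝ) U (𝓝 0) := by
    have h := (hweak k y).sub_const ⟪b k, y⟫_ℝ
    rw [sub_self] at h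
    refine h.congr fun n => ?_
    rw [real_inner_comm (Z k n) y, inner_sub_left]
  let r : ℕ → ℝ := fun k => 1 / ((k : ℝ) + 1) ^ 2
  have hr0 (k : ℕ) : 0 < r k := by positivity
  have hr : Summable r := summable_one_div_nat_add_one_sq
  have hev (x : ℕ) : ∀ᶠ y in (U : Filter ℕ), ∀ k ∈ Finset.range (x + 1),
      (((k : ℝ) ^ 2)⁻¹ * ‖truncationLp (hint y) k‖ ^ 2 ≤ s k + r k ∧
        μ.real {ω | (k : ℝ) < f y ω} ≤ q k + r k ∧ |⟪b k, Z k y⟫_ℝ| ≤ 1) ∧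
      ∀ l ∈ Finset.range (x + 1), ∀ j ∈ Finset.range (x + 1),
        |⟪Z j l, Z k y⟫_ℝ| ≤ 1 / ((x : ℝ) + 1) := by
    have habs (k : ℕ) (v : Lp ℝ 2 μ) {ε : ℝ} (hε : 0 < ε) :
        ∀ᶠ y in (U : Filter ℕ), |⟪v, Z k y⟫_ℝ| ≤ ε := by
      have h := (hZ k v).abs
      rw [abs_zero] at h
      exact h.eventually_le_const hε
    simp only [Finset.eventually_all, eventually_and]
    refine fun k _ => ⟨⟨?_, ?_, habs k _ one_pos⟩, fun l _ j _ => habs k _ (by positivity)⟩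
    · exact (hslim k).eventually_le_const (lt_add_of_pos_right _ (hr0 k))
    · exact (hqlim k).eventually_le_const (lt_add_of_pos_right _ (hr0 k))
  obtain ⟨φ, x, hφ, hxm, hφx, hp⟩ := exists_strictMono_of_forall_eventually hU hev
  refine ⟨F, hF, φ, hφ, fun ψ hψ => ?_⟩
  have hψk (k : ℕ) : k ∈ Finset.range (x (ψ k) + 1) :=
    Finset.mem_range.2 (Nat.lt_succ_of_le (hψ.le_apply.trans (hxm _)))
  refine ae_tendsto_average_of_almost_orthogonal (fun k => hint (φ (ψ k)))
    (fun k => hnn (φ (ψ k))) hlim (hq.add hr) (fun k => (hp (ψ k) k (hψk k)).1.2.1)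
    (w := fun k => ((k : ℝ) + 1) ^ 2 * (s k + r k) + 2) ?_ ?_ ?_
  · intro k
    obtain ⟨h1, -, h3⟩ := (hp (ψ k) k (hψk k)).1
    set X := truncationLp (hint (φ (ψ k))) k
    have hXle : ‖X‖ ^ 2 ≤ ((k : ℝ) + 1) ^ 2 * (s k + r k) := by
      rcases Nat.eq_zero_or_pos k with rfl | hk
      · have h0 : ‖X‖ ≤ 0 := by simpa using norm_truncationLp_le (hint (φ (ψ 0))) 0
        have : ‖X‖ = 0 := le_antisymm h0 (norm_nonneg _)
        rw [this, zero_pow two_ne_zero]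
        exact mul_nonneg (sq_nonneg _) (add_nonneg (hs0 0) (hr0 0).le)
      · have hk' : (0 : ℝ) < (k : ℝ) ^ 2 := by positivity
        rw [inv_mul_le_iff₀ hk'] at h1
        refine h1.trans (mul_le_mul_of_nonneg_right ?_ (add_nonneg (hs0 k) (hr0 k).le))
        gcongr
        linarith
    have hexp : ‖X‖ ^ 2 = ‖b k‖ ^ 2 + 2 * ⟪b k, X - b k⟫_ℝ + ‖X - b k‖ ^ 2 := by
      rw [← norm_add_sq_real, add_sub_cancel]
    have h4 : -1 ≤ ⟪b k, X - b k⟫_ℝ := (abs_le.1 h3).1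
    have := sq_nonneg ‖b k‖
    linarith
  · refine ((hs.add hr).add (hr.mul_left 2)).congr fun k => ?_
    simp only [r]
    field_simp
  · intro j k hjk
    have hlt := hψ hjk
    have hl : φ (ψ j) ∈ Finset.range (x (ψ k) + 1) :=
      Finset.mem_range.2 (Nat.lt_succ_of_le (hφx _ _ hlt))
    have hj : j ∈ Finset.range (x (ψ k) + 1) :=
      Finset.mem_range.2 (hjk.trans (Finset.mem_range.1 (hψk k)))
    refine ((hp (ψ k) k (hψk k)).2 _ hl j hj).trans ?_
    have : (k : ℝ) ≤ x (ψ k) := by exact_mod_cast hψ.le_apply.trans (hxm _)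
    gcongr

end Truncation

/-- Komlós' theorem: every `L¹`-bounded sequence of integrable real functions has a
subsequence `g` such that the Cesàro means of every subsequence of `g` converge a.e.
to a fixed integrable function `F`. -/
theorem komlos
    {Ω : Type*} [MeasurableSpace Ω] (μ : Measure Ω) [IsProbabilityMeasure μ]
    (f : ℕ → Ω → ℝ) (hint : ∀ n, Integrable (f n) μ)
    (hbd : ∃ C : ℝ, ∀ n, ∫ ω, |f n ω| ∂μ ≤ C) :
    ∃ (F : Ω → ℝ), Integrable F μ ∧ ∃ φ : ℕ → ℕ, StrictMono φ ∧
      ∀ ψ : ℕ → ℕ, StrictMono ψ →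
        ∀ᵐ ω ∂μ, Tendsto
          (fun n : ℕ => (∑ k ∈ Finset.range n, f (φ (ψ k)) ω) / n)
          atTop (𝓝 (F ω)) := by
  obtain ⟨C, hC⟩ := hbd
  obtain ⟨F₁, hF₁, φ₁, hφ₁, h₁⟩ := komlos_of_nonneg (f := fun n ω => max (f n ω) 0) (C := C)
    (fun n => (hint n).pos_part) (fun n ω => le_max_right _ _) fun n =>
      (integral_mono (hint n).pos_part (hint n).abs fun ω =>
        max_le (le_abs_self _) (abs_nonneg _)).trans (hC n)
  obtain ⟨F₂, hF₂, φ₂, hφ₂, h₂⟩ := komlos_of_nonneg (f := fun n ω => max (-f (φ₁ n) ω) 0) (C := C)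
    (fun n => (hint (φ₁ n)).neg_part) (fun n ω => le_max_right _ _) fun n =>
      (integral_mono (hint (φ₁ n)).neg_part (hint (φ₁ n)).abs fun ω =>
        max_le (neg_le_abs _) (abs_nonneg _)).trans (hC (φ₁ n))
  refine ⟨F₁ - F₂, hF₁.sub hF₂, φ₁ ∘ φ₂, hφ₁.comp hφ₂, fun ψ hψ => ?_⟩
  filter_upwards [h₁ (φ₂ ∘ ψ) (hφ₂.comp hψ), h₂ ψ hψ] with ω hω₁ hω₂
  refine (hω₁.sub hω₂).congr fun n => ?_
  rw [← sub_div, ← Finset.sum_sub_distrib]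
  congr 1
  refine Finset.sum_congr rfl fun k _ => ?_
  exact max_zero_sub_max_neg_zero_eq_self (f (φ₁ (φ₂ (ψ k))) ω)
end
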